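/- For every prime p there exist primes q and r with p < q < r such that A(pqr) > 2p/3 − 3 · p^{3/4} · log p, where log denotes the natural logarithm. -/

import Mathlib

/-- The height `A(n)` of the `n`-th cyclotomic polynomial. -/
noncomputable def cycHeight (n : ℕ) : ℕ :=
  (Finset.range ((Polynomial.cyclotomic n ℤ).natDegree + 1)).sup
    fun k => ((Polynomial.cyclotomic n ℤ).coeff k).natAbs

open Polynomial in
theorem exists_linear_relation_of_natDegree_lt {E ι : Type*} [Field E] [Fintype ι] (D : ℕ)
    (hD : D < Fintype.card ι) (w : ι → E[X]) (hw : ∀ i, (w i).natDegree < D) :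
    ∃ c : ι → E, c ≠ 0 ∧ ∑ i, C (c i) * w i = 0 := by
  classical
  let φ : (ι → E) →ₗ[E] (Fin D → E) :=
    { toFun := fun c j => ∑ i, c i * (w i).coeff j
      map_add' := fun a b => by
        funext j
        simp [add_mul, Finset.sum_add_distrib]
      map_smul' := fun a b => by
        funext j
        simp [Finset.mul_sum, mul_assoc] }
  have hker : LinearMap.ker φ ≠ ⊥ := LinearMap.ker_ne_bot_of_finrank_lt (by simpa using hD)
  obtain ⟨c, hc, hc0⟩ := (Submodule.ne_bot_iff _).1 hker
  refine ⟨c, hc0, ?_⟩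
  ext j
  rw [finsetSum_coeff, coeff_zero]
  simp only [coeff_C_mul]
  by_cases hj : j < D
  · exact congrFun (LinearMap.mem_ker.1 hc) ⟨j, hj⟩
  · refine Finset.sum_eq_zero fun i _ => ?_
    rw [coeff_eq_zero_of_natDegree_lt ((hw i).trans_le (not_lt.1 hj)), mul_zero]

open Polynomial in
theorem sum_ne_zero_of_natDegree_injective {E ι : Type*} [Field E] [Fintype ι] (w : ι → E[X])
    (hw : ∀ i, w i ≠ 0) (hinj : Function.Injective fun i => (w i).natDegree) (c : ι → E)
    (hc : c ≠ 0) : ∑ i, C (c i) * w i ≠ 0 := by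
  intro h
  have hdeg := degree_sum_eq_of_disjoint (fun i => C (c i) * w i) Finset.univ (by
    rintro i ⟨-, hi⟩ j ⟨-, hj⟩ hij heq
    have hci : c i ≠ 0 := fun h => hi (by simp [h])
    have hcj : c j ≠ 0 := fun h => hj (by simp [h])
    simp only [Function.comp, degree_C_mul hci, degree_C_mul hcj] at heq
    exact hij (hinj (natDegree_eq_of_degree_eq heq)))
  rw [h, degree_zero] at hdeg
  apply hc
  funext i
  by_contra hi
  have := Finset.le_sup (f := fun i => degree (C (c i) * w i)) (Finset.mem_univ i)
  rw [← hdeg, le_bot_iff, degree_eq_bot] at this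
  exact (mul_ne_zero (C_ne_zero.2 hi) (hw i)) this

open Polynomial in
/-- Stepanov's bound for the number of points at which an odd degree polynomial takes a
nonsquare value. -/
theorem two_mul_card_nonsquare_le {E : Type*} [Field E] [Fintype E] [DecidableEq E] {l m : ℕ}
    [ExpChar E l] {b g : ℕ} (hb : 0 < b) (hQ : l ^ m = 2 * b + (2 * g + 1))
    (hcard : Fintype.card E = (l ^ m) ^ 2) (h : E[X]) (hdeg : h.natDegree = 2 * g + 1) :
    2 * (Finset.univ.filter fun t => h.eval t ^ ((Fintype.card E - 1) / 2) = -1).card ≤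
      Fintype.card E + 2 * (2 * g + 1) * l ^ m := by
  set Q := l ^ m with hQdef
  set e := b + g + 1 with he
  set a := b + 2 * g + 1 with ha
  have hQa : Q = a + b := by omega
  have hh0 : h ≠ 0 := by
    rintro rfl
    simp at hdeg
  have hde : e * (2 * g + 1) = g * Q + a := by rw [hQ, he, ha]; ring
  have hQe : Q * e = (Fintype.card E - 1) / 2 + e := by
    have : Fintype.card E - 1 = 2 * (2 * (b + g) * (b + g + 1)) := by
      rw [hcard, hQ]
      have : (2 * b + (2 * g + 1)) ^ 2 = 2 * (2 * (b + g) * (b + g + 1)) + 1 := by ring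
      omega
    rw [this, Nat.mul_div_cancel_left _ (by norm_num), hQ, he]
    ring
  let u : ℕ → E[X] := fun s => if s < a then X ^ s else X ^ (s - a) * h ^ e
  let v : ℕ → E[X] := fun s => if s < a then X ^ (Q * s) else -(X ^ (Q * (s - a)) * h ^ e)
  have hu0 : ∀ s, u s ≠ 0 := by
    intro s
    simp only [u]
    split_ifs
    · exact pow_ne_zero _ X_ne_zero
    · exact mul_ne_zero (pow_ne_zero _ X_ne_zero) (pow_ne_zero _ hh0)
  have hudeg : ∀ s, (u s).natDegree = if s < a then s else s + Q * g := by
    intro s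
    simp only [u]
    split_ifs with hs
    · simp
    · rw [natDegree_mul (pow_ne_zero _ X_ne_zero) (pow_ne_zero _ hh0), natDegree_X_pow,
        natDegree_pow, hdeg, hde, mul_comm g Q]
      omega
  have hvdeg : ∀ s, (v s).natDegree = if s < a then Q * s else Q * (s - a) + (Q * g + a) := by
    intro s
    simp only [v]
    split_ifs with hs
    · simp
    · rw [natDegree_neg, natDegree_mul (pow_ne_zero _ X_ne_zero) (pow_ne_zero _ hh0),
        natDegree_X_pow, natDegree_pow, hdeg, hde, mul_comm g Q]
  have hQpos : 0 < Q := by omega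
  obtain ⟨c, hc0, hc⟩ := exists_linear_relation_of_natDegree_lt (ι := Fin a × Fin Q)
    (Q * (a - 1) + a) (by
      simp only [Fintype.card_prod, Fintype.card_fin]
      obtain ⟨a', ha'⟩ : ∃ a', a = a' + 1 := ⟨a - 1, by omega⟩
      rw [ha', Nat.add_sub_cancel]
      nlinarith) (fun x => v x.2 * X ^ (x.1 : ℕ)) (by
      rintro ⟨⟨k, hk⟩, ⟨s, hs⟩⟩
      have hv0 : v s ≠ 0 := by
        simp only [v]
        split_ifs
        · exact pow_ne_zero _ X_ne_zero
        · exact neg_ne_zero.2 (mul_ne_zero (pow_ne_zero _ X_ne_zero) (pow_ne_zero _ hh0))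
      simp only
      rw [natDegree_mul hv0 (pow_ne_zero _ X_ne_zero), natDegree_X_pow, hvdeg]
      split_ifs with hsa
      · have : Q * s ≤ Q * (a - 1) := Nat.mul_le_mul_left _ (by omega)
        omega
      · have h1 : Q * (s - a) ≤ Q * (b - 1) := Nat.mul_le_mul_left _ (by omega)
        have h2 : Q * (a - 1) = Q * (b - 1) + Q * g + Q * (g + 1) := by
          rw [← mul_add, ← mul_add]
          congr 1
          omega
        have h3 : Q * 1 ≤ Q * (g + 1) := Nat.mul_le_mul_left _ (by omega)
        omega)
  let w : Fin a × Fin Q → E[X] := fun x => u x.2 * X ^ (Q * (x.1 : ℕ))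
  have hw0 : ∀ x, w x ≠ 0 := fun x => mul_ne_zero (hu0 _) (pow_ne_zero _ X_ne_zero)
  have hwdeg : ∀ x, (w x).natDegree =
      (x.2 : ℕ) + Q * ((if (x.2 : ℕ) < a then 0 else g) + x.1) := by
    intro x
    simp only [w]
    rw [natDegree_mul (hu0 _) (pow_ne_zero _ X_ne_zero), natDegree_X_pow, hudeg]
    split_ifs <;> ring
  have hinj : Function.Injective fun x => (w x).natDegree := by
    intro x y hxy
    simp only [hwdeg] at hxy
    have h1 : (x.2 : ℕ) = y.2 := by
      have := congrArg (· % Q) hxy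
      simpa [Nat.add_mul_mod_self_left, Nat.mod_eq_of_lt x.2.2, Nat.mod_eq_of_lt y.2.2] using this
    rw [h1] at hxy
    have h2 := Nat.eq_of_mul_eq_mul_left hQpos (Nat.add_left_cancel hxy)
    exact Prod.ext (Fin.ext (by omega)) (Fin.ext h1)
  set A : E[X] := ∑ x, C (c x ^ Q) * w x with hA
  have hA0 : A ≠ 0 := by
    refine sum_ne_zero_of_natDegree_injective w hw0 hinj (fun x => c x ^ Q) fun h0 => hc0 ?_
    funext x
    exact pow_eq_zero_iff hQpos.ne' |>.1 (congrFun h0 x)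
  have hAdeg : A.natDegree ≤ Q * (g + a) - 1 := by
    refine natDegree_sum_le_of_forall_le _ _ fun x _ => ?_
    refine (natDegree_C_mul_le _ _).trans ?_
    rw [hwdeg]
    have h1 : Q * ((if (x.2 : ℕ) < a then 0 else g) + x.1) ≤ Q * (g + (a - 1)) := by
      refine Nat.mul_le_mul_left _ ?_
      have := x.1.2
      split_ifs <;> omega
    have h2 : Q * (g + a) = Q * (g + (a - 1)) + Q := by
      rw [← Nat.mul_succ]
      congr 1
    have := x.2.2
    omega
  have hfrob : ∀ t : E, (t ^ Q) ^ Q = t := by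
    intro t
    rw [← pow_mul, ← sq, ← hcard, FiniteField.pow_card]
  have hroot : ∀ t, h.eval t ^ ((Fintype.card E - 1) / 2) = -1 → A.eval t = 0 := by
    intro t ht
    refine pow_eq_zero_iff hQpos.ne' |>.1 ?_
    have hv : ∀ s, (u s).eval t ^ Q = (v s).eval t := by
      intro s
      simp only [u, v]
      split_ifs
      · simp [← pow_mul, mul_comm]
      · have : (h.eval t ^ e) ^ Q = -h.eval t ^ e := by
          rw [← pow_mul, mul_comm, hQe, pow_add, ht, neg_one_mul]
        simp only [eval_mul, eval_pow, eval_X, eval_neg, mul_pow, this, ← pow_mul]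
        rw [mul_comm (s - a) Q, mul_neg]
    have h0 := congrArg (eval t) hc
    rw [eval_finsetSum, eval_zero] at h0
    have hsum : ∀ f : Fin a × Fin Q → E, (∑ x, f x) ^ Q = ∑ x, f x ^ Q :=
      fun f => sum_pow_char_pow l m Finset.univ f
    rw [hA, eval_finsetSum, hsum, ← h0]
    refine Finset.sum_congr rfl fun x _ => ?_
    simp only [w, eval_mul, eval_C, eval_pow, eval_X]
    rw [mul_pow, hfrob, mul_pow, hv, mul_comm Q, pow_mul, hfrob]
  have hle : (Finset.univ.filter fun t => h.eval t ^ ((Fintype.card E - 1) / 2) = -1).card ≤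
      A.natDegree := by
    refine card_le_degree_of_subset_roots fun t ht => ?_
    rw [mem_roots hA0]
    exact hroot t (by simpa using ht)
  have h1 : 1 ≤ Q * (g + a) := Nat.mul_pos hQpos (by omega)
  have h2 : 2 * (Q * (g + a)) ≤ Q ^ 2 + 2 * (2 * g + 1) * Q := by
    have : 2 * a = Q + (2 * g + 1) := by omega
    nlinarith
  have h3 : Fintype.card E = Q ^ 2 := hcard
  omega

open Polynomial in
theorem two_mul_card_nonsquare_le_of_simple_root {E : Type*} [Field E] [Fintype E] [DecidableEq E]
    {l m : ℕ} [ExpChar E l] {b g : ℕ} (hb : 0 < b) (hQ : l ^ m = 2 * b + (2 * g + 1))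
    (hcard : Fintype.card E = (l ^ m) ^ 2) (f : E[X]) (hdeg : f.natDegree = 2 * g + 2) (r : E)
    (hr : f.eval r = 0) (hr' : f.derivative.eval r ≠ 0) :
    2 * (Finset.univ.filter fun t => f.eval t ^ ((Fintype.card E - 1) / 2) = -1).card ≤
      Fintype.card E + 2 * (2 * g + 1) * l ^ m := by
  have hpow : (Fintype.card E - 1) / 2 = 2 * (b + g) * (b + g + 1) := by
    have : Fintype.card E - 1 = 2 * (2 * (b + g) * (b + g + 1)) := by
      rw [hcard, hQ]
      have : (2 * b + (2 * g + 1)) ^ 2 = 2 * (2 * (b + g) * (b + g + 1)) + 1 := by ring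
      omega
    rw [this, Nat.mul_div_cancel_left _ (by norm_num)]
  have heven : Fintype.card E - 1 = 2 * ((Fintype.card E - 1) / 2) := by
    rw [hpow, hcard, hQ]
    have : (2 * b + (2 * g + 1)) ^ 2 = 2 * (2 * (b + g) * (b + g + 1)) + 1 := by ring
    omega
  have hf0 : taylor r f ≠ 0 := fun h => hr' (by
    rw [← taylor_coeff_one, h, coeff_zero])
  have htrail : (taylor r f).natTrailingDegree = 1 := by
    refine le_antisymm (natTrailingDegree_le_of_ne_zero (by rwa [taylor_coeff_one])) ?_
    refine Nat.one_le_iff_ne_zero.2 fun h => ?_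
    rw [natTrailingDegree_eq_zero] at h
    rcases h with h | h
    · exact hf0 h
    · exact h (by rw [taylor_coeff_zero, hr])
  have hrev : (taylor r f).reverse.natDegree = 2 * g + 1 := by
    rw [reverse_natDegree, htrail, natDegree_taylor, hdeg]
    rfl
  refine le_trans ?_ (two_mul_card_nonsquare_le hb hQ hcard _ hrev)
  refine Nat.mul_le_mul_left _ (Finset.card_le_card_of_injOn (fun y => (y - r)⁻¹) ?_ ?_)
  · intro y hy
    simp only [Finset.coe_filter, Finset.mem_univ, true_and, Set.mem_ofPred_eq] at hy ⊢
    have hyr : y - r ≠ 0 := by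
      intro h
      rw [sub_eq_zero] at h
      rw [h, hr, zero_pow (by rw [hpow]; positivity)] at hy
      exact one_ne_zero (neg_eq_zero.1 hy.symm)
    let inv : Invertible (y - r) := invertibleOfNonzero hyr
    have h1 := eval₂_reverse_mul_pow (RingHom.id E) (y - r) (taylor r f)
    rw [eval₂_id, eval₂_id, invOf_eq_inv, taylor_eval, sub_add_cancel, natDegree_taylor,
      hdeg] at h1
    rw [← h1, mul_pow, ← pow_mul, show (2 * g + 2) * ((Fintype.card E - 1) / 2)
      = (2 * ((Fintype.card E - 1) / 2)) * (g + 1) by ring, ← heven, pow_mul,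
      FiniteField.pow_card_sub_one_eq_one _ hyr, one_pow, mul_one] at hy
    exact hy
  · intro x _ y _ hxy
    simpa using hxy

theorem trace_pow_card_eq {p : ℕ} [Fact p.Prime] {E : Type*} [Field E] [Finite E]
    [Algebra (ZMod p) E] (y : E) :
    Algebra.trace (ZMod p) E (y ^ p) = Algebra.trace (ZMod p) E y := by
  have := Algebra.trace_eq_of_algEquiv (FiniteField.frobeniusAlgEquivOfAlgebraic (ZMod p) E) y
  simpa using this

theorem card_pow_sub_self_eq_le {p : ℕ} (hp : 1 < p) {E : Type*} [Field E] [Fintype E]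
    [DecidableEq E] (w : E) : (Finset.univ.filter fun y : E => y ^ p - y = w).card ≤ p := by
  open Polynomial in
  have hdeg : (X ^ p - X - C w : E[X]).natDegree = p := by
    rw [natDegree_sub_C, FiniteField.X_pow_card_sub_X_natDegree_eq E hp]
  have h0 : (X ^ p - X - C w : E[X]) ≠ 0 := by
    intro h
    rw [h, natDegree_zero] at hdeg
    omega
  refine le_trans (card_le_degree_of_subset_roots (p := X ^ p - X - C w) fun t ht => ?_) hdeg.le
  rw [mem_roots h0]
  simpa [sub_eq_zero] using ht

/-- Lower bound for the number of units at which `x + c / x` has trace zero, in a field in which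
`(y ^ p - y) ^ 2 = 4 * c` has a root. -/
theorem card_le_mul_card_trace_eq_zero {p m : ℕ} [Fact p.Prime] (hp2 : p ≠ 2) {E : Type*}
    [Field E] [Fintype E] [DecidableEq E] [Algebra (ZMod p) E] (hm : 2 ≤ m)
    (hcard : Fintype.card E = (p ^ m) ^ 2) {c : ZMod p} (hc : c ≠ 0) (r : E)
    (hr : (r ^ p - r) ^ 2 = 4 * algebraMap (ZMod p) E c) :
    p ^ (2 * m) ≤ p * (Finset.univ.filter fun x : E => x ≠ 0 ∧
      Algebra.trace (ZMod p) E (x + algebraMap (ZMod p) E c / x) = 0).card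
        + 4 * p * p ^ m + 4 * p := by
  have hp := (Fact.out : p.Prime)
  have hp3 : 3 ≤ p := by
    have := hp.two_le
    omega
  have : CharP E p := charP_of_injective_algebraMap (algebraMap (ZMod p) E).injective p
  have : ExpChar E p := ExpChar.prime hp
  have hchar : ringChar E = p := ringChar.eq E p ▸ rfl
  have h2 : (2 : E) ≠ 0 := by
    intro h
    have h2 : ((2 : ℕ) : E) = 0 := by exact_mod_cast h
    rw [CharP.cast_eq_zero_iff E p] at h2
    exact hp2 ((Nat.prime_dvd_prime_iff_eq hp Nat.prime_two).1 h2)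
  set γ := algebraMap (ZMod p) E c with hγ
  have hγ0 : γ ≠ 0 := by simpa [hγ] using hc
  obtain ⟨b, hb, hQ⟩ : ∃ b, 0 < b ∧ p ^ m = 2 * b + (2 * (p - 1) + 1) := by
    have hodd : Odd (p ^ m) := (hp.odd_of_ne_two hp2).pow
    have h1 : p ^ 2 ≤ p ^ m := Nat.pow_le_pow_right (by omega) hm
    have h3 : 3 * p ≤ p ^ 2 := by nlinarith
    obtain ⟨s, hs⟩ := hodd
    exact ⟨s - (p - 1), by omega, by omega⟩
  open Polynomial in
  have hbase : (X ^ p - X : E[X]).natDegree = p :=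
    FiniteField.X_pow_card_sub_X_natDegree_eq E (by omega)
  set f : E[X] := (X ^ p - X) ^ 2 - C (4 * γ) with hf
  have hfdeg : f.natDegree = 2 * (p - 1) + 2 := by
    rw [hf, natDegree_sub_C, natDegree_pow, hbase]
    omega
  have hfeval : ∀ y, f.eval y = (y ^ p - y) ^ 2 - 4 * γ := by
    intro y
    simp [hf]
  have hr1 : r ^ p - r ≠ 0 := by
    intro h
    rw [h] at hr
    refine mul_ne_zero ?_ hγ0 (hr.symm.trans (by simp))
    rw [show (4 : E) = 2 * 2 by norm_num]
    exact mul_ne_zero h2 h2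
  have hder : f.derivative.eval r ≠ 0 := by
    simp only [hf, derivative_sub, derivative_C, derivative_pow, derivative_X, eval_sub,
      eval_mul, eval_pow, eval_X, map_natCast]
    simp [hr1, h2]
  have hstep := two_mul_card_nonsquare_le_of_simple_root hb hQ hcard f hfdeg r
    (by rw [hfeval, hr, sub_self]) hder
  set h := (Fintype.card E - 1) / 2
  have hdiv : Fintype.card E / 2 = h := by
    have : Odd (Fintype.card E) := by
      rw [hcard]
      exact ((hp.odd_of_ne_two hp2).pow).pow
    obtain ⟨s, hs⟩ := this
    omega
  set Z := Finset.univ.filter fun y => f.eval y = 0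
  set N := Finset.univ.filter fun y => f.eval y ^ h = -1
  set S := Finset.univ.filter fun y => f.eval y ^ h = 1
  have hf0 : f ≠ 0 := by
    intro h
    rw [h, natDegree_zero] at hfdeg
    omega
  have hZ : Z.card ≤ 2 * p := by
    have : Z.card ≤ f.natDegree := by
      refine card_le_degree_of_subset_roots fun t ht => ?_
      rw [mem_roots hf0]
      simpa [Z] using ht
    omega
  have hcover : Fintype.card E ≤ Z.card + N.card + S.card := by
    have hsub : (Finset.univ : Finset E) ⊆ Z ∪ N ∪ S := by
      intro y _
      simp only [Z, N, S, Finset.mem_union, Finset.mem_filter, Finset.mem_univ, true_and]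
      by_cases hy : f.eval y = 0
      · exact Or.inl (Or.inl hy)
      · have := FiniteField.pow_dichotomy (by rwa [hchar]) hy
        rw [hdiv] at this
        tauto
    have h1 := Finset.card_le_card hsub
    rw [Finset.card_univ] at h1
    have h3 := Finset.card_union_le (Z ∪ N) S
    have h4 := Finset.card_union_le Z N
    omega
  set P : Finset (E × E) := Finset.univ.filter fun x => x.1 ≠ 0 ∧ x.2 ^ p - x.2 = x.1 + γ / x.1
    with hP
  have hPS : 2 * S.card ≤ P.card := by
    classical
    have hsub : (P.filter fun x => x.2 ∈ S).card ≤ P.card :=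
      Finset.card_le_card (Finset.filter_subset _ _)
    refine le_trans ?_ hsub
    refine Finset.mul_card_image_le_card_of_maps_to (f := Prod.snd) (t := S)
      (fun x hx => (Finset.mem_filter.1 hx).2) 2 fun y hy => ?_
    have hy1 : f.eval y ^ h = 1 := (Finset.mem_filter.1 hy).2
    have hy0 : f.eval y ≠ 0 := by
      intro h0
      have : h ≠ 0 := by
        rw [← hdiv, hcard]
        have h1 : p ^ 2 ≤ p ^ m := Nat.pow_le_pow_right (by omega) hm
        have h3 : 3 * p ≤ p ^ 2 := by nlinarith
        have : 2 ≤ (p ^ m) ^ 2 := by nlinarith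
        omega
      rw [h0, zero_pow this] at hy1
      exact zero_ne_one hy1
    obtain ⟨z, hz⟩ := (FiniteField.isSquare_iff (by rwa [hchar]) hy0).2 (by rw [hdiv]; exact hy1)
    rw [hfeval] at hz hy0
    have hz0 : z ≠ 0 := by
      rintro rfl
      exact hy0 (by simpa using hz)
    set w := y ^ p - y with hw
    have hprod : ((w + z) / 2) * ((w - z) / 2) = γ := by
      field_simp
      linear_combination hz
    have hsum : (w + z) / 2 + (w - z) / 2 = w := by
      field_simp
      ring
    have hx1 : (w + z) / 2 ≠ 0 := fun h0 => hγ0 (by rw [← hprod, h0, zero_mul])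
    have hx2 : (w - z) / 2 ≠ 0 := fun h0 => hγ0 (by rw [← hprod, h0, mul_zero])
    have hne : (w + z) / 2 ≠ (w - z) / 2 := by
      intro h0
      field_simp at h0
      have : (2 : E) * z = 0 := by linear_combination h0
      exact (mul_ne_zero h2 hz0) this
    have hpair : ({((w + z) / 2, y), ((w - z) / 2, y)} : Finset (E × E)) ⊆
        (P.filter fun x => x.2 ∈ S).filter fun x => x.2 = y := by
      intro x hx
      rw [Finset.mem_insert, Finset.mem_singleton] at hx
      simp only [Finset.mem_filter, hP, Finset.mem_univ, true_and]
      rcases hx with rfl | rfl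
      · refine ⟨⟨⟨hx1, ?_⟩, hy⟩, rfl⟩
        rw [← hw, ← hprod, mul_div_cancel_left₀ _ hx1, hsum]
      · refine ⟨⟨⟨hx2, ?_⟩, hy⟩, rfl⟩
        rw [← hw, ← hprod, mul_div_cancel_right₀ _ hx2, add_comm, hsum]
    refine le_trans ?_ (Finset.card_le_card hpair)
    rw [Finset.card_pair (by simpa using hne)]
  have hPN : P.card ≤ p * (Finset.univ.filter fun x : E => x ≠ 0 ∧
      Algebra.trace (ZMod p) E (x + γ / x) = 0).card := by
    refine Finset.card_le_mul_card_image_of_maps_to (f := Prod.fst) ?_ p fun x hx => ?_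
    · intro x hx
      simp only [hP, Finset.mem_filter, Finset.mem_univ, true_and] at hx ⊢
      refine ⟨hx.1, ?_⟩
      rw [← hx.2, map_sub, trace_pow_card_eq, sub_self]
    · refine le_trans ?_ (card_pow_sub_self_eq_le (p := p) (by omega) (x + γ / x))
      refine Finset.card_le_card_of_injOn Prod.snd ?_ ?_
      · intro z hz
        simp only [hP, Finset.coe_filter, Finset.mem_filter, Finset.mem_univ, true_and,
          Set.mem_ofPred_eq] at hz ⊢
        rw [← hz.2]
        exact hz.1.2
      · intro z hz z' hz' heq
        simp only [Finset.coe_filter, Set.mem_ofPred_eq] at hz hz'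
        exact Prod.ext (hz.2.trans hz'.2.symm) heq
  have hpm : p ^ (2 * m) = Fintype.card E := by rw [hcard, ← pow_mul, mul_comm]
  have hlast : 2 * (2 * (p - 1) + 1) * p ^ m ≤ 4 * p * p ^ m :=
    Nat.mul_le_mul_right _ (by omega)
  rw [hpm]
  omega

open Polynomial in
theorem exists_forall_finrank_dvd_root {p : ℕ} [Fact p.Prime] (c : ZMod p) :
    ∃ d : ℕ, 0 < d ∧ ∀ (E : Type) [Field E] [Finite E] [Algebra (ZMod p) E],
      d ∣ Module.finrank (ZMod p) E →
        ∃ r : E, (r ^ p - r) ^ 2 = 4 * algebraMap (ZMod p) E c := by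
  have hp := (Fact.out : p.Prime)
  set f : (ZMod p)[X] := (X ^ p - X) ^ 2 - C (4 * c) with hf
  have hfdeg : f.natDegree = 2 * p := by
    rw [hf, natDegree_sub_C, natDegree_pow,
      FiniteField.X_pow_card_sub_X_natDegree_eq _ hp.one_lt]
  have hp1 := hp.pos
  have hnu : ¬IsUnit f := fun h => by
    have := natDegree_eq_zero_of_isUnit h
    omega
  obtain ⟨P, hP, hPf⟩ := WfDvdMonoid.exists_irreducible_factor hnu (by
    intro h
    rw [h, natDegree_zero] at hfdeg
    omega)
  have : Fact (Irreducible P) := ⟨hP⟩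
  have hfr : Module.finrank (ZMod p) (AdjoinRoot P) = P.natDegree :=
    (AdjoinRoot.powerBasis hP.ne_zero).finrank.trans (AdjoinRoot.powerBasis_dim _)
  have : Module.Finite (ZMod p) (AdjoinRoot P) := (AdjoinRoot.powerBasis hP.ne_zero).finite
  have : Finite (AdjoinRoot P) := Module.finite_of_finite (ZMod p)
  refine ⟨P.natDegree, hP.natDegree_pos, fun E _ _ _ hd => ?_⟩
  obtain ⟨φ⟩ := FiniteField.nonempty_algHom_of_finrank_dvd (F := ZMod p) (K := AdjoinRoot P)
    (L := E) (hfr ▸ hd)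
  have h0 : aeval (AdjoinRoot.root P) f = 0 := by
    obtain ⟨g, hg⟩ := hPf
    rw [hg, AdjoinRoot.aeval_eq, map_mul, AdjoinRoot.mk_self, zero_mul]
  refine ⟨φ (AdjoinRoot.root P), ?_⟩
  have h1 := congrArg φ h0
  rw [← aeval_algHom_apply, map_zero] at h1
  have h4 : algebraMap (ZMod p) E 4 = 4 := map_ofNat _ 4
  rw [← sub_eq_zero, ← h1]
  simp [hf, h4]

open Polynomial in
/-- The multiplicative function on monic polynomials taking `X - r` to `ψ (r + c / r)` for `r ≠ 0`
and `X` to zero. -/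
noncomputable def kloostermanChar {F : Type*} [Field F] [DecidableEq F] (ψ : AddChar F ℂ) (c : F)
    (f : F[X]) : ℂ :=
  if f.coeff 0 = 0 then 0 else ψ (-f.nextCoeff - c * (f.coeff 1 / f.coeff 0))

section

variable {F : Type*} [Field F] [DecidableEq F] (ψ : AddChar F ℂ) (c : F)

open Polynomial

theorem kloostermanChar_mul {f g : F[X]} (hf : f.Monic) (hg : g.Monic) :
    kloostermanChar ψ c (f * g) = kloostermanChar ψ c f * kloostermanChar ψ c g := by
  unfold kloostermanChar
  rw [mul_coeff_zero, mul_coeff_one, hf.nextCoeff_mul hg]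
  by_cases h1 : f.coeff 0 = 0
  · simp [h1]
  by_cases h2 : g.coeff 0 = 0
  · simp [h2]
  rw [if_neg (mul_ne_zero h1 h2), if_neg h1, if_neg h2, ← AddChar.map_add_eq_mul]
  congr 1
  field_simp
  ring

theorem kloostermanChar_one : kloostermanChar ψ c 1 = 1 := by
  have : (1 : F[X]).nextCoeff = 0 := nextCoeff_C_eq_zero 1
  simp [kloostermanChar, this, coeff_one]

theorem kloostermanChar_pow {f : F[X]} (hf : f.Monic) (k : ℕ) :
    kloostermanChar ψ c (f ^ k) = kloostermanChar ψ c f ^ k := by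
  induction k with
  | zero => simp [kloostermanChar_one]
  | succ k ih => rw [pow_succ, kloostermanChar_mul ψ c (hf.pow k) hf, ih, pow_succ]

end

theorem adjoin_simple_inv (F : Type*) {E : Type*} [Field F] [Field E] [Algebra F E] (x : E) :
    IntermediateField.adjoin F {x⁻¹} = IntermediateField.adjoin F {x} := by
  apply le_antisymm
  · rw [IntermediateField.adjoin_simple_le_iff]
    exact inv_mem (IntermediateField.mem_adjoin_simple_self F x)
  · rw [IntermediateField.adjoin_simple_le_iff]
    have := inv_mem (IntermediateField.mem_adjoin_simple_self F x⁻¹)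
    rwa [inv_inv] at this

open Polynomial in
theorem nextCoeff_minpoly_inv {F E : Type*} [Field F] [Field E] [Algebra F E]
    [FiniteDimensional F E] {x : E} (hx : x ≠ 0) :
    (minpoly F x⁻¹).nextCoeff = (minpoly F x).coeff 1 / (minpoly F x).coeff 0 := by
  have hxint : IsIntegral F x := IsIntegral.of_finite F x
  have hxint' : IsIntegral F x⁻¹ := IsIntegral.of_finite F x⁻¹
  set P := minpoly F x with hP
  have hP0 : P.coeff 0 ≠ 0 := minpoly.coeff_zero_ne_zero hxint hx
  have hadj := adjoin_simple_inv F x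
  have hdeg : (minpoly F x⁻¹).natDegree = P.natDegree := by
    rw [← IntermediateField.adjoin.finrank hxint', ← IntermediateField.adjoin.finrank hxint, hadj]
  have htrail : P.natTrailingDegree = 0 := natTrailingDegree_eq_zero.2 (Or.inr hP0)
  have hrevdeg : P.reverse.natDegree = P.natDegree := by
    rw [reverse_natDegree, htrail, Nat.sub_zero]
  have hlead : P.reverse.leadingCoeff = P.coeff 0 := by
    rw [reverse_leadingCoeff, trailingCoeff, htrail]
  have hroot : aeval x⁻¹ P.reverse = 0 := by
    let inv : Invertible x := invertibleOfNonzero hx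
    have h1 := eval₂_reverse_mul_pow (algebraMap F E) x P
    rw [← aeval_def, ← aeval_def, minpoly.aeval, invOf_eq_inv] at h1
    exact (mul_eq_zero.1 h1).resolve_right (pow_ne_zero _ hx)
  have heq : minpoly F x⁻¹ = C (P.coeff 0)⁻¹ * P.reverse := by
    refine (eq_of_monic_of_dvd_of_natDegree_le (minpoly.monic hxint') ?_ ?_ ?_).symm
    · rw [Monic, leadingCoeff_C_mul_of_isUnit (IsUnit.mk0 _ (inv_ne_zero hP0)), hlead,
        inv_mul_cancel₀ hP0]
    · refine minpoly.dvd F _ ?_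
      rw [map_mul, hroot, mul_zero]
    · rw [hdeg, natDegree_C_mul (inv_ne_zero hP0), hrevdeg]
  have hpos : 0 < P.natDegree := minpoly.natDegree_pos hxint
  rw [nextCoeff_of_natDegree_pos (by rw [hdeg]; exact hpos), hdeg, heq, coeff_C_mul,
    coeff_reverse, revAt_le (by omega), Nat.sub_sub_self hpos]
  field_simp

/-- The Kloosterman character of a power of the minimal polynomial is a trace character. -/
theorem kloostermanChar_minpoly_pow {F E : Type*} [Field F] [DecidableEq F] [Field E] [Algebra F E]
    [FiniteDimensional F E] (ψ : AddChar F ℂ) (c : F) {x : E} (hx : x ≠ 0) :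
    kloostermanChar ψ c (minpoly F x) ^ (Module.finrank F E / (minpoly F x).natDegree) =
      ψ (Algebra.trace F E (x + algebraMap F E c / x)) := by
  have hxint : IsIntegral F x := IsIntegral.of_finite F x
  have hxint' : IsIntegral F x⁻¹ := IsIntegral.of_finite F x⁻¹
  have hP0 : (minpoly F x).coeff 0 ≠ 0 := minpoly.coeff_zero_ne_zero hxint hx
  have hadj := adjoin_simple_inv F x
  have hfr : Module.finrank F E / (minpoly F x).natDegree =
      Module.finrank (IntermediateField.adjoin F {x}) E := by
    rw [← Module.finrank_mul_finrank F (IntermediateField.adjoin F {x}) E,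
      IntermediateField.adjoin.finrank hxint,
      Nat.mul_div_cancel_left _ (minpoly.natDegree_pos hxint)]
  rw [kloostermanChar, if_neg hP0, ← AddChar.map_nsmul_eq_pow, hfr]
  congr 1
  have hsmul : algebraMap F E c / x = c • x⁻¹ := by rw [Algebra.smul_def, div_eq_mul_inv]
  rw [hsmul, map_add, map_smul,
    trace_eq_finrank_mul_minpoly_nextCoeff F x, trace_eq_finrank_mul_minpoly_nextCoeff F x⁻¹,
    nextCoeff_minpoly_inv hx, hadj]
  simp only [nsmul_eq_mul, smul_eq_mul]
  ring

open Polynomial in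
theorem card_filter_minpoly_eq {F E : Type} [Field F] [Finite F] [Field E] [Fintype E]
    [DecidableEq F[X]] [Algebra F E] {P : F[X]} (hP : P.Monic) (hirr : Irreducible P)
    (hd : P.natDegree ∣ Module.finrank F E) :
    (Finset.univ.filter fun x : E => minpoly F x = P).card = P.natDegree := by
  classical
  have : Fact (Irreducible P) := ⟨hirr⟩
  have hfr : Module.finrank F (AdjoinRoot P) = P.natDegree :=
    (AdjoinRoot.powerBasis hirr.ne_zero).finrank.trans (AdjoinRoot.powerBasis_dim _)
  have : Module.Finite F (AdjoinRoot P) := (AdjoinRoot.powerBasis hirr.ne_zero).finite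
  have : Finite (AdjoinRoot P) := Module.finite_of_finite F
  have h1 := FiniteField.natCard_algHom_of_finrank_dvd (F := F) (K := AdjoinRoot P) (L := E)
    (hfr ▸ hd)
  rw [hfr, Nat.card_congr (AdjoinRoot.equiv E F P hirr.ne_zero)] at h1
  rw [← h1, ← Fintype.card_subtype, ← Nat.card_eq_fintype_card]
  refine Nat.card_congr (Equiv.subtypeEquivRight fun x => ?_)
  rw [mem_aroots]
  constructor
  · intro h
    exact ⟨hirr.ne_zero, h ▸ minpoly.aeval F x⟩
  · intro h
    exact (minpoly.eq_of_irreducible_of_monic hirr h.2 hP).symm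

section

open Polynomial

theorem natDegree_eq_sum_card_pow_dvd {F : Type*} [Field F] [DecidableEq F]
    [DecidableRel fun a b : F[X] => a ∣ b] {f : F[X]}
    (hf : f.Monic) (T : Finset F[X])
    (hT : ∀ P ∈ T, P.Monic ∧ Irreducible P)
    (hfT : ∀ P : F[X], P.Monic → Irreducible P → P ∣ f → P ∈ T) :
    f.natDegree = ∑ P ∈ T, P.natDegree *
      ((Finset.Icc 1 f.natDegree).filter fun k => P ^ k ∣ f).card := by
  classical
  have hf0 := hf.ne_zero
  set s := UniqueFactorizationMonoid.normalizedFactors f with hs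
  have hprod : s.prod = f := by
    have h1 := UniqueFactorizationMonoid.prod_normalizedFactors_eq hf0
    rwa [hf.normalize_eq_self] at h1
  have hmem : ∀ P, P ∈ s ↔ Irreducible P ∧ normalize P = P ∧ P ∣ f := fun P =>
    UniqueFactorizationMonoid.mem_normalizedFactors_iff' hf0
  have hmonic : ∀ P ∈ s, P.Monic := fun P hP => by
    have h := (hmem P).1 hP
    rw [← h.2.1]
    exact monic_normalize h.1.ne_zero
  conv_lhs => rw [← hprod, natDegree_multiset_prod_of_monic s hmonic, Finset.sum_multiset_map_count]
  have hsub : s.toFinset ⊆ T := by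
    intro P hP
    rw [Multiset.mem_toFinset] at hP
    exact hfT P (hmonic P hP) ((hmem P).1 hP).1 ((hmem P).1 hP).2.2
  rw [Finset.sum_subset hsub]
  · refine Finset.sum_congr rfl fun P hP => ?_
    obtain ⟨hPm, hPi⟩ := hT P hP
    rw [smul_eq_mul, mul_comm]
    congr 1
    have hcount : ∀ k, P ^ k ∣ f ↔ k ≤ s.count P := by
      intro k
      rw [pow_dvd_iff_le_emultiplicity,
        UniqueFactorizationMonoid.emultiplicity_eq_count_normalizedFactors hPi hf0,
        hPm.normalize_eq_self]
      exact_mod_cast Iff.rfl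
    have hle : s.count P ≤ f.natDegree := by
      have h1 := natDegree_le_of_dvd ((hcount _).2 le_rfl) hf0
      rw [natDegree_pow] at h1
      exact (Nat.le_mul_of_pos_right _ hPi.natDegree_pos).trans h1
    have : ((Finset.Icc 1 f.natDegree).filter fun k => P ^ k ∣ f) = Finset.Icc 1 (s.count P) := by
      ext k
      rw [Finset.mem_filter, hcount, Finset.mem_Icc, Finset.mem_Icc]
      omega
    rw [this]
    simp
  · intro P _ hP
    rw [Multiset.mem_toFinset] at hP
    rw [Multiset.count_eq_zero_of_notMem hP, zero_smul]

variable {F : Type*} [Field F] [Fintype F] [DecidableEq F]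

variable (F) in
/-- The monic polynomials of degree `m` over a finite field. -/
noncomputable def monicsOfDegree (m : ℕ) : Finset F[X] :=
  Finset.univ.image fun v : Fin m → F => X ^ m + ∑ i, C (v i) * X ^ (i : ℕ)

theorem mem_monicsOfDegree {m : ℕ} {f : F[X]} :
    f ∈ monicsOfDegree F m ↔ f.Monic ∧ f.natDegree = m := by
  rw [monicsOfDegree, Finset.mem_image]
  constructor
  · rintro ⟨v, -, rfl⟩
    have hlt := degree_sum_fin_lt v
    refine ⟨monic_X_pow_add hlt, ?_⟩
    rw [natDegree_eq_of_degree_eq (q := (X ^ m : F[X])), natDegree_X_pow]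
    exact degree_add_eq_left_of_degree_lt (by rwa [degree_X_pow])
  · rintro ⟨hf, rfl⟩
    refine ⟨fun i => f.coeff i, Finset.mem_univ _, ?_⟩
    conv_rhs => rw [hf.as_sum]
    rw [Finset.sum_range]

variable (F) in
/-- The monic irreducible polynomials of degree dividing `j`, for `0 < j`. -/
noncomputable def primesOfDegreeDvd (j : ℕ) : Finset F[X] := by
  classical
  exact ((Finset.range (j + 1)).biUnion (monicsOfDegree F)).filter
    fun P => Irreducible P ∧ P.natDegree ∣ j

theorem mem_primesOfDegreeDvd {j : ℕ} (hj : 0 < j) {P : F[X]} :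
    P ∈ primesOfDegreeDvd F j ↔ P.Monic ∧ Irreducible P ∧ P.natDegree ∣ j := by
  classical
  rw [primesOfDegreeDvd, Finset.mem_filter, Finset.mem_biUnion]
  constructor
  · rintro ⟨⟨i, -, hi⟩, h⟩
    exact ⟨(mem_monicsOfDegree.1 hi).1, h⟩
  · rintro ⟨h1, h2⟩
    exact ⟨⟨P.natDegree, Finset.mem_range.2 (Nat.lt_succ_of_le (Nat.le_of_dvd hj h2.2)),
      mem_monicsOfDegree.2 ⟨h1, rfl⟩⟩, h2⟩

/-- Newton's identities for the sums of a multiplicative function over monic polynomials. -/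
theorem mul_sum_monicsOfDegree (χ : F[X] → ℂ)
    (hmul : ∀ f g : F[X], f.Monic → g.Monic → χ (f * g) = χ f * χ g)
    (hpow : ∀ (f : F[X]) (k : ℕ), f.Monic → χ (f ^ k) = χ f ^ k) (m : ℕ) :
    (m : ℂ) * ∑ f ∈ monicsOfDegree F m, χ f = ∑ j ∈ Finset.Icc 1 m,
      (∑ P ∈ primesOfDegreeDvd F j, (P.natDegree : ℂ) * χ P ^ (j / P.natDegree)) *
        ∑ f ∈ monicsOfDegree F (m - j), χ f := by
  classical
  set T : Finset F[X] := ((Finset.range (m + 1)).biUnion (monicsOfDegree F)).filter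
    fun P => Irreducible P with hTdef
  have hT : ∀ P, P ∈ T ↔ P.Monic ∧ Irreducible P ∧ P.natDegree ≤ m := by
    intro P
    rw [hTdef, Finset.mem_filter, Finset.mem_biUnion]
    constructor
    · rintro ⟨⟨i, hi, h⟩, h'⟩
      obtain ⟨h1, rfl⟩ := mem_monicsOfDegree.1 h
      exact ⟨h1, h', Nat.lt_succ_iff.1 (Finset.mem_range.1 hi)⟩
    · rintro ⟨h1, h2, h3⟩
      exact ⟨⟨_, Finset.mem_range.2 (Nat.lt_succ_of_le h3), mem_monicsOfDegree.2 ⟨h1, rfl⟩⟩, h2⟩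
  have hsplit : ∀ P ∈ T, ∀ k, (∑ f ∈ monicsOfDegree F m, if P ^ k ∣ f then χ f else 0) =
      if k * P.natDegree ≤ m then
        χ P ^ k * ∑ f ∈ monicsOfDegree F (m - k * P.natDegree), χ f else 0 := by
    intro P hP k
    obtain ⟨hPm, hPi, -⟩ := (hT P).1 hP
    rw [← Finset.sum_filter]
    split_ifs with hk
    · rw [Finset.mul_sum]
      symm
      refine Finset.sum_bij (fun g _ => P ^ k * g) ?_ ?_ ?_ ?_
      · intro g hg
        obtain ⟨h1, h2⟩ := mem_monicsOfDegree.1 hg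
        refine Finset.mem_filter.2 ⟨mem_monicsOfDegree.2 ⟨(hPm.pow k).mul h1, ?_⟩,
          dvd_mul_right _ _⟩
        rw [(hPm.pow k).natDegree_mul h1, hPm.natDegree_pow, h2]
        omega
      · intro g _ g' _ h
        exact mul_left_cancel₀ (pow_ne_zero _ hPm.ne_zero) h
      · intro f hf
        obtain ⟨hf1, g, rfl⟩ := Finset.mem_filter.1 hf
        obtain ⟨h1, h2⟩ := mem_monicsOfDegree.1 hf1
        have hg : g.Monic := (hPm.pow k).of_mul_monic_left h1
        refine ⟨g, mem_monicsOfDegree.2 ⟨hg, ?_⟩, rfl⟩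
        rw [(hPm.pow k).natDegree_mul hg, hPm.natDegree_pow] at h2
        omega
      · intro g hg
        rw [hmul _ _ (hPm.pow k) (mem_monicsOfDegree.1 hg).1, hpow _ _ hPm]
    · refine Finset.sum_eq_zero fun f hf => absurd ?_ hk
      obtain ⟨hf1, hf2⟩ := Finset.mem_filter.1 hf
      obtain ⟨h1, rfl⟩ := mem_monicsOfDegree.1 hf1
      rw [← hPm.natDegree_pow]
      exact natDegree_le_of_dvd hf2 h1.ne_zero
  have hfilter : ∀ j ∈ Finset.Icc 1 m,
      primesOfDegreeDvd F j = T.filter fun P => P.natDegree ∣ j := by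
    intro j hj
    obtain ⟨hj1, hjm⟩ := Finset.mem_Icc.1 hj
    ext P
    rw [mem_primesOfDegreeDvd hj1, Finset.mem_filter, hT]
    constructor
    · rintro ⟨h1, h2, h3⟩
      exact ⟨⟨h1, h2, (Nat.le_of_dvd hj1 h3).trans hjm⟩, h3⟩
    · rintro ⟨⟨h1, h2, -⟩, h3⟩
      exact ⟨h1, h2, h3⟩
  calc (m : ℂ) * ∑ f ∈ monicsOfDegree F m, χ f
      = ∑ f ∈ monicsOfDegree F m, ∑ P ∈ T, ∑ k ∈ Finset.Icc 1 m,
          (P.natDegree : ℂ) * if P ^ k ∣ f then χ f else 0 := by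
        rw [Finset.mul_sum]
        refine Finset.sum_congr rfl fun f hf => ?_
        obtain ⟨h1, h2⟩ := mem_monicsOfDegree.1 hf
        have h3 := natDegree_eq_sum_card_pow_dvd h1 T (fun P hP => ⟨((hT P).1 hP).1,
          ((hT P).1 hP).2.1⟩) (fun P hPm hPi hPd => (hT P).2 ⟨hPm, hPi,
            h2 ▸ natDegree_le_of_dvd hPd h1.ne_zero⟩)
        rw [h2] at h3
        conv_lhs => rw [h3]
        rw [Nat.cast_sum, Finset.sum_mul]
        refine Finset.sum_congr rfl fun P _ => ?_
        rw [← Finset.mul_sum, ← Finset.sum_filter, Finset.sum_const, nsmul_eq_mul]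
        push_cast
        ring
    _ = ∑ P ∈ T, ∑ k ∈ Finset.Icc 1 m, (P.natDegree : ℂ) *
          if k * P.natDegree ≤ m then
            χ P ^ k * ∑ f ∈ monicsOfDegree F (m - k * P.natDegree), χ f else 0 := by
        rw [Finset.sum_comm]
        refine Finset.sum_congr rfl fun P hP => ?_
        rw [Finset.sum_comm]
        refine Finset.sum_congr rfl fun k _ => ?_
        rw [← Finset.mul_sum, hsplit P hP]
    _ = ∑ P ∈ T, ∑ j ∈ Finset.Icc 1 m, if P.natDegree ∣ j then
          (P.natDegree : ℂ) * χ P ^ (j / P.natDegree) * ∑ f ∈ monicsOfDegree F (m - j), χ f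
          else 0 := by
        refine Finset.sum_congr rfl fun P hP => ?_
        have hd : 0 < P.natDegree := ((hT P).1 hP).2.1.natDegree_pos
        simp_rw [mul_ite, mul_zero]
        rw [← Finset.sum_filter, ← Finset.sum_filter]
        refine Finset.sum_nbij' (fun k => k * P.natDegree) (fun j => j / P.natDegree) ?_ ?_ ?_ ?_ ?_
        · intro k hk
          simp only [Finset.mem_filter, Finset.mem_Icc] at hk ⊢
          exact ⟨⟨Nat.mul_pos hk.1.1 hd, hk.2⟩, dvd_mul_left _ _⟩
        · intro j hj
          simp only [Finset.mem_filter, Finset.mem_Icc] at hj ⊢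
          rw [Nat.div_mul_cancel hj.2]
          exact ⟨⟨Nat.div_pos (Nat.le_of_dvd hj.1.1 hj.2) hd, (Nat.div_le_self _ _).trans hj.1.2⟩,
            hj.1.2⟩
        · intro k _
          exact Nat.mul_div_cancel _ hd
        · intro j hj
          exact Nat.div_mul_cancel (Finset.mem_filter.1 hj).2
        · intro k _
          rw [Nat.mul_div_cancel _ hd, mul_assoc]
    _ = _ := by
        rw [Finset.sum_comm]
        refine Finset.sum_congr rfl fun j hj => ?_
        rw [hfilter j hj, Finset.sum_mul]
        exact (Finset.sum_filter _ _).symm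

end

section

open Polynomial

variable {F : Type*} [Field F] [Fintype F] [DecidableEq F]

theorem sum_kloostermanChar_zero (ψ : AddChar F ℂ) (c : F) :
    ∑ f ∈ monicsOfDegree F 0, kloostermanChar ψ c f = 1 := by
  have : monicsOfDegree F 0 = {1} := by
    ext f
    rw [mem_monicsOfDegree, Finset.mem_singleton]
    constructor
    · rintro ⟨h1, h2⟩
      exact h1.natDegree_eq_zero.1 h2
    · rintro rfl
      exact ⟨monic_one, natDegree_one⟩
  rw [this, Finset.sum_singleton, kloostermanChar_one]

theorem sum_kloostermanChar_one (ψ : AddChar F ℂ) (c : F) :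
    ∑ f ∈ monicsOfDegree F 1, kloostermanChar ψ c f =
      ∑ x : F, if x = 0 then 0 else ψ (x + c / x) := by
  symm
  refine Finset.sum_bij (fun x _ => X - C x) ?_ ?_ ?_ ?_
  · intro x _
    exact mem_monicsOfDegree.2 ⟨monic_X_sub_C x, natDegree_X_sub_C x⟩
  · intro x _ y _ h
    exact C_injective (sub_right_injective h)
  · intro f hf
    obtain ⟨h1, h2⟩ := mem_monicsOfDegree.1 hf
    refine ⟨-f.coeff 0, Finset.mem_univ _, ?_⟩
    rw [C_neg, sub_neg_eq_add]
    exact (h1.eq_X_add_C h2).symm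
  · intro x _
    by_cases hx : x = 0
    · simp [kloostermanChar, hx]
    · have h1 : (X - C x : F[X]).coeff 0 = -x := by simp
      have h2 : (X - C x : F[X]).coeff 1 = 1 := by simp [coeff_X]
      rw [kloostermanChar, h1, h2, nextCoeff_X_sub_C, if_neg hx, if_neg (neg_ne_zero.2 hx)]
      congr 1
      field_simp
      ring

theorem sum_kloostermanChar_two {ψ : AddChar F ℂ} (hψ : ψ ≠ 1) {c : F} (hc : c ≠ 0) :
    ∑ f ∈ monicsOfDegree F 2, kloostermanChar ψ c f = Fintype.card F := by
  have hval : ∀ u v : F, kloostermanChar ψ c (X ^ 2 + C u * X + C v) =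
      if v = 0 then 0 else ψ (u * (-1 - c / v)) := by
    intro u v
    have h0 : (X ^ 2 + C u * X + C v).coeff 0 = v := by simp
    have h1 : (X ^ 2 + C u * X + C v).coeff 1 = u := by simp [coeff_X_pow, coeff_C]
    have h2 : (X ^ 2 + C u * X + C v).natDegree = 2 := by compute_degree!
    have h3 : (X ^ 2 + C u * X + C v).nextCoeff = u := by
      rw [nextCoeff_of_natDegree_pos (by omega), h2, h1]
    rw [kloostermanChar, h0, h1, h3]
    split_ifs with hv
    · rfl
    · congr 1
      field_simp
  have hbij : ∑ f ∈ monicsOfDegree F 2, kloostermanChar ψ c f =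
      ∑ w : F × F, kloostermanChar ψ c (X ^ 2 + C w.2 * X + C w.1) := by
    symm
    refine Finset.sum_bij (fun w _ => X ^ 2 + C w.2 * X + C w.1) ?_ ?_ ?_ ?_
    · intro w _
      exact mem_monicsOfDegree.2 ⟨by monicity!, by compute_degree!⟩
    · intro w _ w' _ h
      have h0 := congrArg (fun f => coeff f 0) h
      have h1 := congrArg (fun f => coeff f 1) h
      simp only [coeff_add, coeff_X_pow, coeff_C_mul_X, coeff_C] at h0 h1
      exact Prod.ext (by simpa using h0) (by simpa using h1)
    · intro f hf
      obtain ⟨h1, h2⟩ := mem_monicsOfDegree.1 hf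
      refine ⟨(f.coeff 0, f.coeff 1), Finset.mem_univ _, ?_⟩
      conv_rhs => rw [h1.as_sum, h2]
      simp [Finset.sum_range_succ]
      ring
    · intro w _
      rfl
  have hprim : ψ.IsPrimitive := AddChar.IsPrimitive.of_ne_one hψ
  rw [hbij, Fintype.sum_prod_type]
  simp only [hval]
  rw [Finset.sum_eq_single (-c)]
  · simp only [if_neg (neg_ne_zero.2 hc)]
    have h0 : (-1 : F) - c / -c = 0 := by
      field_simp
      ring
    simp [h0]
  · intro v _ hv
    by_cases hv0 : v = 0
    · simp [hv0]
    simp only [if_neg hv0]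
    rw [AddChar.sum_mulShift _ hprim, if_neg]
    · exact Nat.cast_zero
    · intro h
      apply hv
      field_simp at h
      linear_combination -h
  · intro h
    exact absurd (Finset.mem_univ _) h

theorem sum_kloostermanChar_of_three_le {ψ : AddChar F ℂ} (hψ : ψ ≠ 1) (c : F) {m : ℕ}
    (hm : 3 ≤ m) : ∑ f ∈ monicsOfDegree F m, kloostermanChar ψ c f = 0 := by
  obtain ⟨a, ha⟩ := AddChar.ne_one_iff.1 hψ
  have hmem : ∀ (b : F) (f : F[X]), f ∈ monicsOfDegree F m →
      f + C b * X ^ (m - 1) ∈ monicsOfDegree F m := by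
    intro b f hf
    obtain ⟨h1, h2⟩ := mem_monicsOfDegree.1 hf
    have hlt : (C b * X ^ (m - 1) : F[X]).degree < f.degree := by
      refine (degree_C_mul_X_pow_le _ _).trans_lt ?_
      rw [degree_eq_natDegree h1.ne_zero, h2]
      exact_mod_cast (by omega : m - 1 < m)
    refine mem_monicsOfDegree.2 ⟨h1.add_of_left hlt, ?_⟩
    rw [natDegree_eq_of_degree_eq (degree_add_eq_left_of_degree_lt hlt), h2]
  have hval : ∀ f ∈ monicsOfDegree F m,
      kloostermanChar ψ c (f + C (-a) * X ^ (m - 1)) = ψ a * kloostermanChar ψ c f := by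
    intro f hf
    obtain ⟨h1, h2⟩ := mem_monicsOfDegree.1 hf
    obtain ⟨h3, h4⟩ := mem_monicsOfDegree.1 (hmem (-a) f hf)
    have hc0 : (f + C (-a) * X ^ (m - 1)).coeff 0 = f.coeff 0 := by
      rw [coeff_add, coeff_C_mul_X_pow, if_neg (by omega), add_zero]
    have hc1 : (f + C (-a) * X ^ (m - 1)).coeff 1 = f.coeff 1 := by
      rw [coeff_add, coeff_C_mul_X_pow, if_neg (by omega), add_zero]
    have hn : (f + C (-a) * X ^ (m - 1)).nextCoeff = f.nextCoeff - a := by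
      rw [nextCoeff_of_natDegree_pos (by omega), nextCoeff_of_natDegree_pos (by omega), h4, h2,
        coeff_add, coeff_C_mul_X_pow, if_pos rfl, sub_eq_add_neg]
    rw [kloostermanChar, kloostermanChar, hc0, hc1, hn]
    split_ifs
    · rw [mul_zero]
    · rw [← AddChar.map_add_eq_mul]
      congr 1
      ring
  have hshift : ∑ f ∈ monicsOfDegree F m, kloostermanChar ψ c f =
      ψ a * ∑ f ∈ monicsOfDegree F m, kloostermanChar ψ c f := by
    rw [Finset.mul_sum]
    conv_rhs => rw [Finset.sum_congr rfl fun f hf => (hval f hf).symm]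
    refine Finset.sum_nbij' (fun f => f + C a * X ^ (m - 1))
      (fun f => f + C (-a) * X ^ (m - 1)) (hmem a) (hmem (-a)) ?_ ?_ ?_
    · intro f _
      rw [C_neg]
      ring
    · intro f _
      rw [C_neg]
      ring
    · intro f _
      congr 1
      rw [C_neg]
      ring
  have : (1 - ψ a) * ∑ f ∈ monicsOfDegree F m, kloostermanChar ψ c f = 0 := by
    linear_combination hshift
  exact (mul_eq_zero.1 this).resolve_left (sub_ne_zero.2 (Ne.symm ha))

/-- The exponential sum attached to `x + c / x` over a finite extension. -/
noncomputable def traceKloosterman (F : Type*) [Field F] (E : Type*) [Field E] [Fintype E]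
    [DecidableEq E] [Algebra F E] (ψ : AddChar F ℂ) (c : F) : ℂ :=
  ∑ x : E, if x = 0 then 0 else ψ (Algebra.trace F E (x + algebraMap F E c / x))

end

open Polynomial in
theorem traceKloosterman_eq_sum_primes {F E : Type} [Field F] [Fintype F] [DecidableEq F] [Field E]
    [Fintype E] [DecidableEq E] [Algebra F E] (ψ : AddChar F ℂ) (c : F) :
    traceKloosterman F E ψ c = ∑ P ∈ primesOfDegreeDvd F (Module.finrank F E),
      (P.natDegree : ℂ) * kloostermanChar ψ c P ^ (Module.finrank F E / P.natDegree) := by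
  classical
  have hpos : 0 < Module.finrank F E := Module.finrank_pos
  have hterm : ∀ x : E, (if x = 0 then 0 else ψ (Algebra.trace F E (x + algebraMap F E c / x))) =
      kloostermanChar ψ c (minpoly F x) ^ (Module.finrank F E / (minpoly F x).natDegree) := by
    intro x
    split_ifs with hx
    · subst hx
      rw [minpoly.zero, natDegree_X, Nat.div_one]
      simp [kloostermanChar, hpos.ne']
    · rw [kloostermanChar_minpoly_pow ψ c hx]
  rw [traceKloosterman, Finset.sum_congr rfl fun x _ => hterm x,
    ← Finset.sum_fiberwise_of_maps_to (g := fun x : E => minpoly F x)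
      (t := primesOfDegreeDvd F (Module.finrank F E))]
  · refine Finset.sum_congr rfl fun P hP => ?_
    obtain ⟨h1, h2, h3⟩ := (mem_primesOfDegreeDvd hpos).1 hP
    rw [← card_filter_minpoly_eq h1 h2 h3, ← nsmul_eq_mul, ← Finset.sum_const]
    refine Finset.sum_congr rfl fun x hx => ?_
    rw [(Finset.mem_filter.1 hx).2, card_filter_minpoly_eq h1 h2 h3]
  · intro x _
    have hxint : IsIntegral F x := IsIntegral.of_finite F x
    exact (mem_primesOfDegreeDvd hpos).2
      ⟨minpoly.monic hxint, minpoly.irreducible hxint, minpoly.degree_dvd hxint⟩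

section

variable {F : Type*} [Field F] [Fintype F] [DecidableEq F]

/-- The power sums of the zeros of the Kloosterman `L`-function, up to sign. -/
noncomputable def kloostermanPowerSum (ψ : AddChar F ℂ) (c : F) (j : ℕ) : ℂ :=
  ∑ P ∈ primesOfDegreeDvd F j, (P.natDegree : ℂ) * kloostermanChar ψ c P ^ (j / P.natDegree)

theorem kloosterman_newton (ψ : AddChar F ℂ) (c : F) (m : ℕ) :
    (m : ℂ) * ∑ f ∈ monicsOfDegree F m, kloostermanChar ψ c f = ∑ j ∈ Finset.Icc 1 m,
      kloostermanPowerSum ψ c j * ∑ f ∈ monicsOfDegree F (m - j), kloostermanChar ψ c f :=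
  mul_sum_monicsOfDegree _ (fun _ _ => kloostermanChar_mul ψ c)
    (fun _ k hf => kloostermanChar_pow ψ c hf k) m

theorem kloostermanPowerSum_one (ψ : AddChar F ℂ) (c : F) :
    kloostermanPowerSum ψ c 1 = ∑ x : F, if x = 0 then 0 else ψ (x + c / x) := by
  have h := kloosterman_newton ψ c 1
  rw [Finset.Icc_self, Finset.sum_singleton, Nat.sub_self, sum_kloostermanChar_zero,
    sum_kloostermanChar_one] at h
  simpa using h.symm

theorem kloostermanPowerSum_two {ψ : AddChar F ℂ} (hψ : ψ ≠ 1) {c : F} (hc : c ≠ 0) :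
    kloostermanPowerSum ψ c 2 = 2 * Fintype.card F - kloostermanPowerSum ψ c 1 ^ 2 := by
  have h := kloosterman_newton ψ c 2
  rw [Finset.sum_Icc_succ_top (by norm_num), Finset.Icc_self, Finset.sum_singleton, Nat.sub_self,
    sum_kloostermanChar_zero, sum_kloostermanChar_two hψ hc, sum_kloostermanChar_one,
    ← kloostermanPowerSum_one] at h
  push_cast at h
  linear_combination -h

theorem kloostermanPowerSum_add_three {ψ : AddChar F ℂ} (hψ : ψ ≠ 1) {c : F} (hc : c ≠ 0) (m : ℕ) :
    kloostermanPowerSum ψ c (m + 3) = -kloostermanPowerSum ψ c 1 * kloostermanPowerSum ψ c (m + 2) -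
      Fintype.card F * kloostermanPowerSum ψ c (m + 1) := by
  have h := kloosterman_newton ψ c (m + 3)
  rw [sum_kloostermanChar_of_three_le hψ c (by omega), Finset.sum_Icc_succ_top (by omega),
    Finset.sum_Icc_succ_top (by omega), Finset.sum_Icc_succ_top (by omega), Finset.sum_eq_zero,
    Nat.sub_self, show m + 3 - (m + 1 + 1) = 1 by omega, show m + 3 - (m + 1) = 2 by omega,
    sum_kloostermanChar_zero, sum_kloostermanChar_one, sum_kloostermanChar_two hψ hc,
    ← kloostermanPowerSum_one] at h
  · linear_combination -h
  · intro j hj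
    rw [sum_kloostermanChar_of_three_le hψ c (by have := (Finset.mem_Icc.1 hj).2; omega), mul_zero]

theorem star_kloostermanPowerSum_one (ψ : AddChar F ℂ) (c : F) :
    (starRingEnd ℂ) (kloostermanPowerSum ψ c 1) = kloostermanPowerSum ψ c 1 := by
  rw [kloostermanPowerSum_one, map_sum]
  refine Fintype.sum_equiv (Equiv.neg F) _ _ fun x => ?_
  by_cases hx : x = 0
  · simp [hx]
  · simp only [hx, if_false, Equiv.neg_apply, neg_eq_zero, div_neg]
    rw [← neg_add, AddChar.map_neg_eq_conj]

end

/-- Sequences with the recurrence of `α ^ n + β ^ n` for complex conjugate `α` and `β`. -/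
theorem abs_le_of_recurrence {K P : ℝ} {u : ℕ → ℝ} (hKP : K ^ 2 ≤ 4 * P) (h1 : u 1 = -K)
    (h2 : u 2 = K ^ 2 - 2 * P) (h3 : ∀ m, u (m + 3) = -K * u (m + 2) - P * u (m + 1)) (n : ℕ) :
    |u (n + 1)| ≤ 2 * √P ^ (n + 1) := by
  have hP : 0 ≤ P := by nlinarith [sq_nonneg K]
  set s := √(4 * P - K ^ 2) with hs
  have hs2 : s ^ 2 = 4 * P - K ^ 2 := Real.sq_sqrt (by linarith)
  set a : ℂ := ⟨-K / 2, s / 2⟩ with ha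
  have hnorm : ‖a‖ = √P := by
    rw [Complex.norm_def, Complex.normSq_apply]
    congr 1
    simp only [ha]
    nlinarith
  have hsq : a ^ 2 = -K * a - P := by
    rw [sq]
    apply Complex.ext
    · simp [ha]
      nlinarith
    · simp [ha]
      ring
  have hu : ∀ m, u (m + 1) = 2 * (a ^ (m + 1)).re ∧ u (m + 2) = 2 * (a ^ (m + 2)).re := by
    intro m
    induction m with
    | zero =>
      refine ⟨?_, ?_⟩
      · simp [ha, h1]
        ring
      · rw [zero_add, hsq, h2]
        simp [ha]
        ring
    | succ m ih =>
      refine ⟨ih.2, ?_⟩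
      have : a ^ (m + 1 + 2) = -K * a ^ (m + 2) - P * a ^ (m + 1) := by
        rw [pow_add, hsq]
        ring
      rw [this, show m + 1 + 2 = m + 3 from rfl, h3, ih.1, ih.2]
      simp
      ring
  rw [(hu n).1, abs_mul, abs_two, ← hnorm, ← norm_pow]
  exact mul_le_mul_of_nonneg_left (Complex.abs_re_le_norm _) (by norm_num)

/-- Sequences with the recurrence of `α ^ n + β ^ n` for distinct real `α` and `β` grow
exponentially fast along even indices. -/
theorem exists_pow_le_of_recurrence {K P : ℝ} {u : ℕ → ℝ} (hKP : 4 * P < K ^ 2)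
    (h1 : u 1 = -K) (h2 : u 2 = K ^ 2 - 2 * P)
    (h3 : ∀ m, u (m + 3) = -K * u (m + 2) - P * u (m + 1)) :
    ∃ B, P < B ∧ ∀ k, 0 < k → B ^ k ≤ u (2 * k) := by
  set s := √(K ^ 2 - 4 * P) with hs
  have hs2 : s ^ 2 = K ^ 2 - 4 * P := Real.sq_sqrt (by linarith)
  set a := (-K + s) / 2 with ha
  set b := (-K - s) / 2 with hb
  have hasq : a ^ 2 = -K * a - P := by rw [ha]; nlinarith
  have hbsq : b ^ 2 = -K * b - P := by rw [hb]; nlinarith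
  have hu : ∀ m, u (m + 1) = a ^ (m + 1) + b ^ (m + 1) ∧ u (m + 2) = a ^ (m + 2) + b ^ (m + 2) := by
    intro m
    induction m with
    | zero =>
      refine ⟨?_, ?_⟩
      · rw [zero_add, h1, ha, hb]
        ring
      · rw [zero_add, h2, ha, hb]
        nlinarith
    | succ m ih =>
      refine ⟨ih.2, ?_⟩
      rw [show m + 1 + 2 = m + 3 from rfl, h3, ih.1, ih.2]
      have e1 : a ^ (m + 3) = a ^ (m + 1) * a ^ 2 := by ring
      have e2 : b ^ (m + 3) = b ^ (m + 1) * b ^ 2 := by ring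
      rw [e1, e2, hasq, hbsq]
      ring
  have heven : ∀ k, 0 < k → u (2 * k) = (a ^ 2) ^ k + (b ^ 2) ^ k := by
    intro k hk
    obtain ⟨j, rfl⟩ : ∃ j, k = j + 1 := ⟨k - 1, by omega⟩
    rw [← pow_mul, ← pow_mul]
    exact (hu (2 * j)).2
  have hsum : 2 * P < a ^ 2 + b ^ 2 := by rw [ha, hb]; nlinarith
  by_cases hab : P < a ^ 2
  · refine ⟨a ^ 2, hab, fun k hk => ?_⟩
    rw [heven k hk]
    have : 0 ≤ (b ^ 2) ^ k := by positivity
    linarith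
  · refine ⟨b ^ 2, by linarith, fun k hk => ?_⟩
    rw [heven k hk]
    have : 0 ≤ (a ^ 2) ^ k := by positivity
    linarith

theorem sum_traceKloosterman {F E : Type*} [Field F] [Fintype F] [DecidableEq F] [Field E]
    [Fintype E] [DecidableEq E] [Algebra F E] (c : F) :
    ∑ ψ : AddChar F ℂ, traceKloosterman F E ψ c = Fintype.card F * (Finset.univ.filter fun x : E =>
      x ≠ 0 ∧ Algebra.trace F E (x + algebraMap F E c / x) = 0).card := by
  simp only [traceKloosterman]
  rw [Finset.sum_comm, Finset.card_filter, Nat.cast_sum, Finset.mul_sum]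
  refine Finset.sum_congr rfl fun x _ => ?_
  by_cases hx : x = 0
  · simp [hx]
  · simp only [hx, if_false, not_false_eq_true, true_and, ne_eq, AddChar.sum_apply_eq_ite]
    split_ifs <;> simp

theorem traceKloosterman_trivial {F E : Type*} [Field F] [Field E]
    [Fintype E] [DecidableEq E] [Algebra F E] (c : F) :
    traceKloosterman F E 1 c = Fintype.card E - 1 := by
  have h : ∀ x : E, (if x = 0 then (0 : ℂ) else
      (1 : AddChar F ℂ) (Algebra.trace F E (x + algebraMap F E c / x))) =
      1 - if x = 0 then 1 else 0 := by
    intro x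
    split_ifs <;> simp
  rw [traceKloosterman, Finset.sum_congr rfl fun x _ => h x, Finset.sum_sub_distrib]
  simp

/-- Weil's bound for Kloosterman sums over a prime field. -/
theorem norm_kloosterman_le {p : ℕ} [Fact p.Prime] (hp2 : p ≠ 2) {ψ : AddChar (ZMod p) ℂ}
    (hψ : ψ ≠ 1) {c : ZMod p} (hc : c ≠ 0) :
    ‖∑ x : ZMod p, if x = 0 then 0 else ψ (x + c / x)‖ ≤ 2 * √p := by
  classical
  have hp := (Fact.out : p.Prime)
  have hp0 : (0 : ℝ) < p := by exact_mod_cast hp.pos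
  let K : AddChar (ZMod p) ℂ → ℝ := fun χ => (kloostermanPowerSum χ c 1).re
  let u : AddChar (ZMod p) ℂ → ℕ → ℝ := fun χ n => -(kloostermanPowerSum χ c n).re
  have hK : ∀ χ, kloostermanPowerSum χ c 1 = (K χ : ℂ) := fun χ =>
    (Complex.conj_eq_iff_re.1 (star_kloostermanPowerSum_one χ c)).symm
  have hcardF : Fintype.card (ZMod p) = p := ZMod.card p
  have hu1 : ∀ χ, u χ 1 = -K χ := fun χ => rfl
  have hu2 : ∀ χ, χ ≠ 1 → u χ 2 = K χ ^ 2 - 2 * p := by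
    intro χ hχ
    simp only [u]
    have : (2 * (p : ℂ) - (K χ : ℂ) ^ 2) = ((2 * p - K χ ^ 2 : ℝ) : ℂ) := by
      push_cast
      ring
    rw [kloostermanPowerSum_two hχ hc, hK, hcardF, this, Complex.ofReal_re]
    ring
  have hu3 : ∀ χ, χ ≠ 1 → ∀ m, u χ (m + 3) = -K χ * u χ (m + 2) - p * u χ (m + 1) := by
    intro χ hχ m
    simp only [u]
    rw [kloostermanPowerSum_add_three hχ hc, hK, hcardF]
    simp
    ring
  have hlow : ∀ χ, χ ≠ 1 → ∀ k, 0 < k → -(2 * (p : ℝ) ^ k) ≤ u χ (2 * k) := by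
    intro χ hχ k hk
    rcases le_or_gt (K χ ^ 2) (4 * p) with h | h
    · have := abs_le_of_recurrence h (hu1 χ) (hu2 χ hχ) (hu3 χ hχ) (2 * k - 1)
      rw [Nat.sub_add_cancel (by omega), pow_mul, Real.sq_sqrt hp0.le] at this
      exact (abs_le.1 this).1
    · obtain ⟨B, hB, h'⟩ := exists_pow_le_of_recurrence h (hu1 χ) (hu2 χ hχ) (hu3 χ hχ)
      have h1 : 0 ≤ B ^ k := pow_nonneg (hp0.le.trans hB.le) k
      have h2 : 0 ≤ (p : ℝ) ^ k := by positivity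
      linarith [h' k hk]
  rw [← kloostermanPowerSum_one, hK, Complex.norm_real, Real.norm_eq_abs]
  have hgoal : K ψ ^ 2 ≤ 4 * p := by
    by_contra hcon
    rw [not_le] at hcon
    obtain ⟨B, hB, hBu⟩ := exists_pow_le_of_recurrence hcon (hu1 ψ) (hu2 ψ hψ) (hu3 ψ hψ)
    obtain ⟨d, hd, hroot⟩ := exists_forall_finrank_dvd_root c
    have hkey : ∀ j, 0 < j → B ^ (2 * d * j) ≤ 10 * p * (p : ℝ) ^ (2 * d * j) := by
      intro j hj
      set k := 2 * d * j with hkdef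
      have hk2 : 2 ≤ k := by
        rw [hkdef, mul_assoc]
        exact Nat.le_mul_of_pos_right _ (Nat.mul_pos hd hj)
      let E := GaloisField p (2 * k)
      have hE0 : 2 * k ≠ 0 := by omega
      let _ : Fintype E := Fintype.ofFinite E
      have hfr : Module.finrank (ZMod p) E = 2 * k := GaloisField.finrank p hE0
      have hcardE : Fintype.card E = (p ^ k) ^ 2 := by
        rw [← Nat.card_eq_fintype_card, GaloisField.card p _ hE0, ← pow_mul, mul_comm]
      obtain ⟨r, hr⟩ := hroot E (by
        rw [hfr, hkdef]
        exact ⟨2 * (2 * j), by ring⟩)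
      have hcount := card_le_mul_card_trace_eq_zero hp2 hk2 hcardE hc r hr
      set N := (Finset.univ.filter fun x : E => x ≠ 0 ∧
        Algebra.trace (ZMod p) E (x + algebraMap (ZMod p) E c / x) = 0).card
      have hsum : ∑ χ : AddChar (ZMod p) ℂ, traceKloosterman (ZMod p) E χ c = p * N := by
        rw [sum_traceKloosterman, hcardF]
      rw [← Finset.add_sum_erase _ _ (Finset.mem_univ 1), traceKloosterman_trivial, hcardE] at hsum
      have hsum' : ∑ χ ∈ Finset.univ.erase 1, u χ (2 * k) = (p : ℝ) ^ (2 * k) - 1 - p * N := by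
        have h1 := congrArg Complex.re hsum
        rw [Complex.add_re, Complex.re_sum] at h1
        have h2 : ∀ χ : AddChar (ZMod p) ℂ, (traceKloosterman (ZMod p) E χ c).re =
            -u χ (2 * k) := by
          intro χ
          rw [traceKloosterman_eq_sum_primes, hfr]
          simp only [u, neg_neg]
          rfl
        have h3 : (((((p ^ k) ^ 2 : ℕ) : ℂ) - 1).re) = (p : ℝ) ^ (2 * k) - 1 := by
          have : ((((p ^ k) ^ 2 : ℕ) : ℂ) - 1) = (((p : ℝ) ^ (2 * k) - 1 : ℝ) : ℂ) := by
            push_cast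
            ring
          rw [this, Complex.ofReal_re]
        have h4 : ((p : ℂ) * N).re = p * N := by simp
        rw [h3, h4, Finset.sum_congr rfl fun χ _ => h2 χ, Finset.sum_neg_distrib] at h1
        linarith
      have hmem : ψ ∈ Finset.univ.erase (1 : AddChar (ZMod p) ℂ) :=
        Finset.mem_erase.2 ⟨hψ, Finset.mem_univ _⟩
      rw [← Finset.add_sum_erase _ _ hmem] at hsum'
      have hrest : -(2 * (p : ℝ) * p ^ k) ≤
          ∑ χ ∈ (Finset.univ.erase (1 : AddChar (ZMod p) ℂ)).erase ψ, u χ (2 * k) := by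
        have h1 := Finset.card_nsmul_le_sum ((Finset.univ.erase (1 : AddChar (ZMod p) ℂ)).erase ψ)
          (fun χ => u χ (2 * k)) (-(2 * (p : ℝ) ^ k)) (fun χ hχ => hlow χ
            (Finset.mem_erase.1 (Finset.mem_erase.1 hχ).2).1 k (by omega))
        have h2 : ((Finset.univ.erase (1 : AddChar (ZMod p) ℂ)).erase ψ).card ≤ p := by
          refine (Finset.card_le_univ _).trans ?_
          exact (AddChar.card_eq (α := ZMod p)).le.trans_eq hcardF
        refine le_trans ?_ h1
        rw [nsmul_eq_mul]
        have h3 : ((((Finset.univ.erase (1 : AddChar (ZMod p) ℂ)).erase ψ).card : ℕ) : ℝ) ≤ p := by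
          exact_mod_cast h2
        have h4 : 0 ≤ (p : ℝ) ^ k := by positivity
        nlinarith
      have hcount' : (p : ℝ) ^ (2 * k) ≤ p * N + 4 * p * p ^ k + 4 * p := by exact_mod_cast hcount
      have h1 := hBu k (by omega)
      have h2 : (1 : ℝ) ≤ p ^ k := one_le_pow₀ (by exact_mod_cast hp.one_le)
      nlinarith
    have hratio : 1 < B / p := by rwa [lt_div_iff₀ hp0, one_mul]
    obtain ⟨j, hj⟩ := pow_unbounded_of_one_lt (10 * (p : ℝ)) hratio
    have h1 := hkey (j + 1) (Nat.succ_pos j)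
    have h2 : (B / p) ^ j ≤ (B / p) ^ (2 * d * (j + 1)) :=
      pow_le_pow_right₀ hratio.le (by nlinarith)
    have h3 : (B / p) ^ (2 * d * (j + 1)) ≤ 10 * p := by
      rw [div_pow, div_le_iff₀ (by positivity)]
      exact h1
    linarith
  have h2 : |K ψ| ≤ √(4 * p) := Real.abs_le_sqrt hgoal
  rwa [Real.sqrt_mul (by norm_num), show √(4 : ℝ) = 2 by
    rw [show (4 : ℝ) = 2 ^ 2 by norm_num]; exact Real.sqrt_sq (by norm_num)] at h2

theorem norm_kloosterman_general_le {p : ℕ} [Fact p.Prime] (hp2 : p ≠ 2)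
    {ψ : AddChar (ZMod p) ℂ} (hψ : ψ ≠ 1) {h k : ZMod p} (hhk : h ≠ 0 ∨ k ≠ 0) :
    ‖∑ x : ZMod p, if x = 0 then 0 else ψ (h * x + k / x)‖ ≤ 2 * √p := by
  have hp := (Fact.out : p.Prime)
  have hprim : ψ.IsPrimitive := AddChar.IsPrimitive.of_ne_one hψ
  have hsqrt : 1 ≤ √(p : ℝ) := Real.one_le_sqrt.2 (by exact_mod_cast hp.one_le)
  have hlin : ∀ a : ZMod p, a ≠ 0 →
      ∑ x : ZMod p, (if x = 0 then 0 else ψ (a * x)) = -1 := by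
    intro a ha
    have h1 := AddChar.sum_mulShift a hprim
    rw [if_neg ha, ← Finset.add_sum_erase _ _ (Finset.mem_univ 0)] at h1
    rw [← Finset.add_sum_erase _ _ (Finset.mem_univ 0), if_pos rfl, zero_add,
      Finset.sum_congr rfl (g := fun x => ψ (x * a))
      (fun x hx => by rw [if_neg (Finset.ne_of_mem_erase hx), mul_comm])]
    rw [zero_mul, AddChar.map_zero_eq_one] at h1
    push_cast at h1
    linear_combination h1
  by_cases hk : k = 0
  · subst hk
    have hh : h ≠ 0 := by tauto
    simp only [zero_div, add_zero]
    rw [hlin h hh, norm_neg, norm_one]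
    linarith
  by_cases hh : h = 0
  · subst hh
    have h1 : ∑ x : ZMod p, (if x = 0 then 0 else ψ (0 * x + k / x)) =
        ∑ x : ZMod p, (if x = 0 then 0 else ψ (k * x)) := by
      refine Fintype.sum_equiv (Equiv.inv (ZMod p)) _ _ fun x => ?_
      simp [div_eq_mul_inv]
    rw [h1, hlin k hk, norm_neg, norm_one]
    linarith
  · have h1 : ∑ x : ZMod p, (if x = 0 then 0 else ψ (h * x + k / x)) =
        ∑ x : ZMod p, (if x = 0 then 0 else ψ (x + (h * k) / x)) := by
      refine Fintype.sum_equiv (Equiv.mulLeft₀ h hh) _ _ fun x => ?_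
      simp only [Equiv.mulLeft₀_apply, mul_eq_zero, hh, false_or]
      split_ifs with hx
      · rfl
      · rw [mul_div_mul_left _ _ hh]
    rw [h1]
    exact norm_kloosterman_le hp2 hψ (mul_ne_zero hh hk)

theorem card_sum_eq_fourier {p : ℕ} [Fact p.Prime] {ψ : AddChar (ZMod p) ℂ} (hψ : ψ ≠ 1)
    (I : Finset (ZMod p)) (y : ZMod p) :
    (p : ℂ) * ((I ×ˢ I).filter fun u => u.1 + u.2 = y).card =
      ∑ h : ZMod p, ψ (h * y) * (∑ u ∈ I, ψ (h * -u)) ^ 2 := by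
  have hprim : ψ.IsPrimitive := AddChar.IsPrimitive.of_ne_one hψ
  have h1 : ∀ h : ZMod p, ψ (h * y) * (∑ u ∈ I, ψ (h * -u)) ^ 2 =
      ∑ u ∈ I ×ˢ I, ψ (h * (y - (u.1 + u.2))) := by
    intro h
    rw [sq, Finset.sum_mul_sum, ← Finset.sum_product', Finset.mul_sum]
    refine Finset.sum_congr rfl fun u _ => ?_
    rw [← AddChar.map_add_eq_mul, ← AddChar.map_add_eq_mul]
    congr 1
    ring
  rw [Finset.sum_congr rfl fun h _ => h1 h, Finset.sum_comm, Finset.card_filter, Nat.cast_sum,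
    Finset.mul_sum]
  refine Finset.sum_congr rfl fun u _ => ?_
  rw [AddChar.sum_mulShift _ hprim, ZMod.card]
  by_cases hu : u.1 + u.2 = y
  · simp [hu]
  · rw [if_neg hu, if_neg (by rw [sub_eq_zero]; exact Ne.symm hu)]
    simp

theorem parseval_indicator {p : ℕ} [Fact p.Prime] {ψ : AddChar (ZMod p) ℂ} (hψ : ψ ≠ 1)
    (I : Finset (ZMod p)) :
    ∑ h : ZMod p, ‖∑ u ∈ I, ψ (h * -u)‖ ^ 2 = p * I.card := by
  have hprim : ψ.IsPrimitive := AddChar.IsPrimitive.of_ne_one hψ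
  have h1 : ∀ h : ZMod p, ((‖∑ u ∈ I, ψ (h * -u)‖ ^ 2 : ℝ) : ℂ) =
      ∑ u ∈ I ×ˢ I, ψ (h * (u.2 - u.1)) := by
    intro h
    rw [Complex.ofReal_pow, ← Complex.mul_conj', map_sum, Finset.sum_mul_sum,
      ← Finset.sum_product']
    refine Finset.sum_congr rfl fun u _ => ?_
    rw [← AddChar.map_neg_eq_conj, ← AddChar.map_add_eq_mul]
    congr 1
    ring
  have h2 : ((∑ h : ZMod p, ‖∑ u ∈ I, ψ (h * -u)‖ ^ 2 : ℝ) : ℂ) = ((p * I.card : ℝ) : ℂ) := by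
    rw [Complex.ofReal_sum, Finset.sum_congr rfl fun h _ => h1 h, Finset.sum_comm,
      Finset.sum_product]
    have h3 : ∀ a ∈ I, ∑ b ∈ I, ∑ h : ZMod p, ψ (h * (b - a)) = p := by
      intro a ha
      rw [Finset.sum_eq_single_of_mem a ha]
      · rw [sub_self, AddChar.sum_mulShift _ hprim, if_pos rfl, ZMod.card]
      · intro b _ hba
        rw [AddChar.sum_mulShift _ hprim, if_neg (sub_ne_zero.2 hba), Nat.cast_zero]
    rw [Finset.sum_congr rfl h3, Finset.sum_const, nsmul_eq_mul]
    push_cast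
    ring
  exact_mod_cast h2

/-- Modular inversion maps some element of one shifted sumset into another one, once the
sumsets are large enough. -/
theorem exists_inverse_in_sumset {p : ℕ} [Fact p.Prime] (hp2 : p ≠ 2) (I : Finset (ZMod p))
    (hI : 2 * √p * (p : ℝ) ^ 2 < (p - 1) * (I.card : ℝ) ^ 2) (a b : ZMod p) :
    ∃ x y : ZMod p, x * y = 1 ∧ (∃ u ∈ I, ∃ v ∈ I, x = a + u + v) ∧
      ∃ u ∈ I, ∃ v ∈ I, y = b + u + v := by
  have hp := (Fact.out : p.Prime)
  obtain ⟨ψ, hψ⟩ : ∃ ψ : AddChar (ZMod p) ℂ, ψ ≠ 1 := by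
    have := AddChar.exists_apply_ne_zero (α := ZMod p) (a := 1) |>.2 one_ne_zero
    obtain ⟨ψ, h⟩ := this
    exact ⟨ψ, AddChar.ne_one_iff.2 ⟨1, h⟩⟩
  by_contra hcon
  push Not at hcon
  set R : ZMod p → ℂ := fun y => ((I ×ˢ I).filter fun u => u.1 + u.2 = y).card with hR
  set J : ZMod p → ℂ := fun h => ∑ u ∈ I, ψ (h * -u) with hJ
  have hFour : ∀ y, p * R y = ∑ h, ψ (h * y) * J h ^ 2 := card_sum_eq_fourier hψ I
  have hR0 : ∀ y, R y ≠ 0 → ∃ u ∈ I, ∃ v ∈ I, y = u + v := by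
    intro y hy
    simp only [hR, ne_eq, Nat.cast_eq_zero, Finset.card_eq_zero] at hy
    obtain ⟨u, hu⟩ := Finset.nonempty_iff_ne_empty.2 hy
    rw [Finset.mem_filter, Finset.mem_product] at hu
    exact ⟨u.1, hu.1.1, u.2, hu.1.2, hu.2.symm⟩
  have hzero : ∑ x : ZMod p, (if x = 0 then 0 else (p * R (x - a)) * (p * R (1 / x - b))) = 0 := by
    refine Finset.sum_eq_zero fun x _ => ?_
    split_ifs with hx
    · rfl
    · by_contra hne
      have h1 : R (x - a) ≠ 0 := fun h => hne (by rw [h]; ring)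
      have h2 : R (1 / x - b) ≠ 0 := fun h => hne (by rw [h]; ring)
      obtain ⟨u, hu, v, hv, h3⟩ := hR0 _ h1
      obtain ⟨u', hu', v', hv', h4⟩ := hR0 _ h2
      exact hcon x (1 / x) (mul_one_div_cancel hx)
        ⟨u, hu, v, hv, by linear_combination h3⟩ u' hu' v' hv' (by linear_combination h4)
  set Kl : ZMod p × ZMod p → ℂ := fun w =>
    ∑ x : ZMod p, if x = 0 then 0 else ψ (w.1 * x + w.2 / x) with hKl
  have hexp : ∑ w : ZMod p × ZMod p,
      J w.1 ^ 2 * J w.2 ^ 2 * ψ (-(w.1 * a + w.2 * b)) * Kl w = 0 := by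
    rw [← hzero]
    simp only [hKl, Finset.mul_sum]
    rw [Finset.sum_comm]
    refine Finset.sum_congr rfl fun x _ => ?_
    split_ifs with hx
    · simp
    · rw [hFour, hFour, Finset.sum_mul_sum, Fintype.sum_prod_type]
      refine Finset.sum_congr rfl fun h _ => Finset.sum_congr rfl fun k _ => ?_
      have : ψ (-(h * a + k * b)) * ψ (h * x + k / x) = ψ (h * (x - a)) * ψ (k * (1 / x - b)) := by
        rw [← AddChar.map_add_eq_mul, ← AddChar.map_add_eq_mul]
        congr 1
        ring
      linear_combination (J h ^ 2 * J k ^ 2) * this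
  rw [← Finset.add_sum_erase _ _ (Finset.mem_univ (0, 0))] at hexp
  have hJ0 : J 0 = I.card := by simp [hJ]
  have hK0 : Kl (0, 0) = p - 1 := by
    have : ∀ x : ZMod p, (if x = 0 then (0 : ℂ) else ψ (0 * x + 0 / x)) =
        1 - if x = 0 then 1 else 0 := by
      intro x
      split_ifs <;> simp
    simp only [hKl]
    rw [Finset.sum_congr rfl fun x _ => this x, Finset.sum_sub_distrib]
    simp [ZMod.card]
  have hmain : ‖J 0 ^ 2 * J 0 ^ 2 * ψ (-((0 : ZMod p) * a + 0 * b)) * Kl (0, 0)‖ =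
      (p - 1) * (I.card : ℝ) ^ 4 := by
    have h1 : (0 : ℝ) ≤ p - 1 := by
      have : (1 : ℝ) ≤ p := by exact_mod_cast hp.one_le
      linarith
    have h2 : J 0 ^ 2 * J 0 ^ 2 * ψ (-((0 : ZMod p) * a + 0 * b)) * Kl (0, 0) =
        (((p - 1) * (I.card : ℝ) ^ 4 : ℝ) : ℂ) := by
      rw [hK0, hJ0]
      simp
      ring
    rw [h2, Complex.norm_real, Real.norm_of_nonneg (by positivity)]
  have herr : ‖∑ w ∈ Finset.univ.erase ((0 : ZMod p), (0 : ZMod p)),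
      J w.1 ^ 2 * J w.2 ^ 2 * ψ (-(w.1 * a + w.2 * b)) * Kl w‖ ≤
      2 * √p * (p * I.card) ^ 2 := by
    calc _ ≤ ∑ w ∈ Finset.univ.erase ((0 : ZMod p), (0 : ZMod p)),
          ‖J w.1‖ ^ 2 * ‖J w.2‖ ^ 2 * (2 * √p) := by
          refine norm_sum_le_of_le _ fun w hw => ?_
          have hw0 : w.1 ≠ 0 ∨ w.2 ≠ 0 := by
            by_contra h
            push Not at h
            exact Finset.ne_of_mem_erase hw (Prod.ext h.1 h.2)
          rw [norm_mul, norm_mul, norm_mul, norm_pow, norm_pow, AddChar.norm_apply, mul_one]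
          exact mul_le_mul_of_nonneg_left (norm_kloosterman_general_le hp2 hψ hw0) (by positivity)
      _ ≤ ∑ w : ZMod p × ZMod p, ‖J w.1‖ ^ 2 * ‖J w.2‖ ^ 2 * (2 * √p) :=
          Finset.sum_le_sum_of_subset_of_nonneg (Finset.subset_univ _)
            fun _ _ _ => by positivity
      _ = _ := by
          rw [← Finset.sum_mul, Fintype.sum_prod_type]
          simp only []
          rw [← Finset.sum_mul_sum]
          have := parseval_indicator hψ I
          simp only [hJ]
          rw [this]
          ring
  have heq : ‖J 0 ^ 2 * J 0 ^ 2 * ψ (-((0 : ZMod p) * a + 0 * b)) * Kl (0, 0)‖ =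
      ‖∑ w ∈ Finset.univ.erase ((0 : ZMod p), (0 : ZMod p)),
        J w.1 ^ 2 * J w.2 ^ 2 * ψ (-(w.1 * a + w.2 * b)) * Kl w‖ := by
    rw [eq_neg_of_add_eq_zero_left hexp, norm_neg]
  rw [hmain] at heq
  rw [← heq] at herr
  have hcard : (0 : ℝ) < (I.card : ℝ) ^ 2 := by
    by_contra h
    have : (I.card : ℝ) ^ 2 = 0 := le_antisymm (not_lt.1 h) (sq_nonneg _)
    rw [this, mul_zero] at hI
    have : 0 ≤ 2 * √p * (p : ℝ) ^ 2 := by positivity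
    linarith
  have := mul_lt_mul_of_pos_right hI hcard
  nlinarith

theorem sixty_lt_of_log_lt {s : ℝ} (h2 : 2 ≤ s ^ 4)
    (h : 18 * Real.log s < s) : 60 < s := by
  have hl2 : 0.69 < Real.log 2 := lt_trans (by norm_num) Real.log_two_gt_d9
  have hpow : ∀ k : ℕ, (2 : ℝ) ^ k ≤ s → k * 0.69 ≤ Real.log s := by
    intro k hk
    have h1 := Real.log_le_log (by positivity) hk
    rw [Real.log_pow] at h1
    nlinarith [(Nat.cast_nonneg k : (0 : ℝ) ≤ k)]
  have h4 : 0.69 ≤ 4 * Real.log s := by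
    have h1 := Real.log_le_log (by norm_num) h2
    rw [Real.log_pow] at h1
    push_cast at h1
    linarith
  have h5 := hpow 1 (by linarith)
  have h6 := hpow 3 (by norm_num at h5 ⊢; linarith)
  have h7 := hpow 5 (by norm_num at h6 ⊢; linarith)
  norm_num at h7
  linarith

/-- Modulo a large prime `p`, some pair of mutually inverse residues lies slightly
above `p / 3`. -/
theorem exists_inverse_pair_near_third {p : ℕ} (hp : p.Prime)
    (hlog : 3 * (p : ℝ) ^ ((3 : ℝ) / 4) * Real.log p < 2 * (p : ℝ) / 3) :
    ∃ a b : ℕ, a * b ≡ 1 [MOD p] ∧ 1 ≤ b ∧ b ≤ a ∧ p ≤ b + 2 * a ∧ 2 * a < p ∧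
      (a : ℝ) < p / 3 + 3 * (p : ℝ) ^ ((3 : ℝ) / 4) * Real.log p := by
  have : Fact p.Prime := ⟨hp⟩
  have hp0 : (0 : ℝ) < p := by exact_mod_cast hp.pos
  obtain ⟨s, hs0, hs⟩ : ∃ s : ℝ, 0 < s ∧ (p : ℝ) = s ^ 4 :=
    ⟨(p : ℝ) ^ ((1 : ℝ) / 4), by positivity, by
      rw [← Real.rpow_natCast, ← Real.rpow_mul hp0.le]; norm_num⟩
  have hs3 : (p : ℝ) ^ ((3 : ℝ) / 4) = s ^ 3 := by
    rw [hs, ← Real.rpow_natCast, ← Real.rpow_mul hs0.le, ← Real.rpow_natCast]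
    norm_num
  have hsqrt : √(p : ℝ) = s ^ 2 := by
    rw [hs, show s ^ 4 = (s ^ 2) ^ 2 by ring, Real.sqrt_sq (by positivity)]
  have hlogp : Real.log p = 4 * Real.log s := by
    rw [hs, Real.log_pow]; norm_num
  rw [hs3, hlogp] at hlog ⊢
  have hs60 : 60 < s := by
    refine sixty_lt_of_log_lt (by rw [← hs]; exact_mod_cast hp.two_le) ?_
    have hpos : 0 < s ^ 3 := by positivity
    rw [hs] at hlog
    by_contra hcon
    nlinarith
  have hlogs : 1 ≤ Real.log s := by
    rw [Real.le_log_iff_exp_le hs0]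
    linarith [Real.exp_one_lt_d9]
  have hL1 := Nat.le_ceil (2 * s ^ 3)
  have hL2 := Nat.ceil_lt_add_one (show 0 ≤ 2 * s ^ 3 by positivity)
  set L := ⌈2 * s ^ 3⌉₊ with hL
  have hs3pos : 216000 < s ^ 3 := by
    have := pow_lt_pow_left₀ hs60 (by norm_num) (n := 3) (by norm_num)
    norm_num at this; exact this
  have hps : 60 * s ^ 3 < p := by rw [hs]; nlinarith
  have hLp : 30 * L + 30 < p + 60 := by
    have : (30 * L + 30 : ℝ) < p + 60 := by linarith
    exact_mod_cast this
  have hpbig : 12960000 < p := by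
    have : (12960000 : ℝ) < p := by linarith
    exact_mod_cast this
  have hinj : Set.InjOn (fun n : ℕ => (n : ZMod p)) (Finset.range L : Finset ℕ) := by
    intro x hx y hy hxy
    rw [Finset.mem_coe, Finset.mem_range] at hx hy
    have := (ZMod.natCast_eq_natCast_iff' x y p).1 hxy
    rwa [Nat.mod_eq_of_lt (by omega), Nat.mod_eq_of_lt (by omega)] at this
  obtain ⟨x, y, hxy, ⟨u, hu, v, hv, hx⟩, u', hu', v', hv', hy⟩ :=
    exists_inverse_in_sumset (p := p) (by omega)
      ((Finset.range L).image fun n : ℕ => (n : ZMod p))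
      (by
        rw [Finset.card_image_of_injOn hinj, Finset.card_range, hsqrt]
        have h1 : (2 * s ^ 3) ^ 2 ≤ (L : ℝ) ^ 2 := pow_le_pow_left₀ (by positivity) hL1 2
        have h2 : (0 : ℝ) < p - 1 := by linarith
        have h3 := mul_le_mul_of_nonneg_left h1 h2.le
        refine lt_of_lt_of_le ?_ h3
        rw [hs]
        have h4 : 2 < s ^ 4 := by rw [← hs]; linarith
        have h5 : 0 < s ^ 6 := by positivity
        nlinarith)
      ((p / 3 + 1 + 2 * L : ℕ) : ZMod p) ((p / 3 + 1 : ℕ) : ZMod p)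
  simp only [Finset.mem_image, Finset.mem_range] at hu hv hu' hv'
  obtain ⟨u, hu, rfl⟩ := hu
  obtain ⟨v, hv, rfl⟩ := hv
  obtain ⟨u', hu', rfl⟩ := hu'
  obtain ⟨v', hv', rfl⟩ := hv'
  refine ⟨p / 3 + 1 + 2 * L + u + v, p / 3 + 1 + u' + v', ?_, by omega, by omega, by omega,
    by omega, ?_⟩
  · rw [← ZMod.natCast_eq_natCast_iff]
    rw [hx, hy] at hxy
    push_cast at hxy ⊢
    exact hxy
  · have h1 : p / 3 + 1 + 2 * L + u + v ≤ p / 3 + 4 * L := by omega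
    have h2 : ((p / 3 + 1 + 2 * L + u + v : ℕ) : ℝ) ≤ ((p / 3 + 4 * L : ℕ) : ℝ) := by
      exact_mod_cast h1
    refine lt_of_le_of_lt h2 ?_
    push_cast
    have h3 : ((p / 3 : ℕ) : ℝ) ≤ p / 3 := by exact_mod_cast Nat.cast_div_le (α := ℝ)
    nlinarith

open Polynomial in
/-- If `A * (1 - X ^ N) = C(X ^ r) * K` with `K` of degree less than `N`, then the coefficients
of `A` are sums of products of coefficients of `C` and `K`. -/
theorem coeff_of_mul_one_sub_X_pow {A C K : ℤ[X]} {N r : ℕ} (hN : 0 < N) (hr : 0 < r)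
    (hK : K.natDegree < N) (h : A * (1 - X ^ N) = expand ℤ r C * K) (n : ℕ) :
    A.coeff n = ∑ f ∈ Finset.range (n / r + 1), C.coeff f * K.coeff ((n - r * f) % N) := by
  set P : PowerSeries ℤ := PowerSeries.mk fun n => K.coeff (n % N) with hP
  have hPK : P * (1 - PowerSeries.X ^ N) = (K : PowerSeries ℤ) := by
    ext m
    rw [mul_sub, mul_one, map_sub, PowerSeries.coeff_mul_X_pow', Polynomial.coeff_coe, hP]
    simp only [PowerSeries.coeff_mk]
    split_ifs with hm
    · rw [← Nat.mod_eq_sub_mod hm, sub_self, coeff_eq_zero_of_natDegree_lt (by omega)]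
    · rw [Nat.mod_eq_of_lt (by omega), sub_zero]
  have hne : (1 - PowerSeries.X ^ N : PowerSeries ℤ) ≠ 0 := by
    intro h0
    have := congrArg (PowerSeries.coeff 0) h0
    rw [map_sub, PowerSeries.coeff_X_pow, if_neg hN.ne] at this
    simp at this
  have hA : (A : PowerSeries ℤ) = (expand ℤ r C : ℤ[X]) * P := by
    refine mul_right_cancel₀ hne ?_
    rw [mul_assoc, hPK, ← Polynomial.coe_mul, ← h]
    push_cast
    rfl
  rw [← Polynomial.coeff_coe, hA, PowerSeries.coeff_mul,
    Finset.Nat.sum_antidiagonal_eq_sum_range_succ_mk]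
  simp only [Polynomial.coeff_coe, coeff_expand hr, hP, PowerSeries.coeff_mk, ite_mul, zero_mul]
  rw [← Finset.sum_filter]
  symm
  refine Finset.sum_bij (fun f _ => r * f) ?_ ?_ ?_ ?_
  · intro f hf
    rw [Finset.mem_range, Nat.lt_succ_iff, Nat.le_div_iff_mul_le hr, mul_comm] at hf
    rw [Finset.mem_filter, Finset.mem_range]
    exact ⟨by omega, dvd_mul_right _ _⟩
  · intro f _ g _ hfg
    exact Nat.eq_of_mul_eq_mul_left hr hfg
  · intro m hm
    rw [Finset.mem_filter, Finset.mem_range] at hm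
    obtain ⟨f, rfl⟩ := hm.2
    exact ⟨f, by
      rw [Finset.mem_range, Nat.lt_succ_iff, Nat.le_div_iff_mul_le hr, mul_comm]; omega, rfl⟩
  · intro f _
    rw [Nat.mul_div_cancel_left _ hr]

open Polynomial in
theorem cyclotomic_prime_mul_prime_mul {p q : ℕ} (hp : p.Prime) (hq : q.Prime) (hpq : p ≠ q) :
    cyclotomic (p * q) ℤ * ((X ^ p - 1) * (X ^ q - 1)) = (X ^ (p * q) - 1) * (X - 1) := by
  have : Fact p.Prime := ⟨hp⟩
  have h1 := cyclotomic_expand_eq_cyclotomic_mul hq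
    (fun h => hpq ((Nat.prime_dvd_prime_iff_eq hq hp).1 h).symm) ℤ
  have h2 : cyclotomic p ℤ * (X - 1) = X ^ p - 1 := cyclotomic_prime_mul_X_sub_one ℤ p
  have h3 : expand ℤ q (cyclotomic p ℤ) * (X ^ q - 1) = X ^ (p * q) - 1 := by
    have := congrArg (expand ℤ q) h2
    simpa [← pow_mul, mul_comm q p] using this
  linear_combination (-cyclotomic (p * q) ℤ * (X ^ q - 1)) * h2 + (X - 1) * h3 -
    (X - 1) * (X ^ q - 1) * h1

open Polynomial in
theorem sum_Ico_X_pow_mul (d u v : ℕ) (huv : u ≤ v) :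
    (∑ i ∈ Finset.Ico u v, (X : ℤ[X]) ^ (i * d)) * (X ^ d - 1) = X ^ (v * d) - X ^ (u * d) := by
  have := geom_sum_Ico_mul ((X : ℤ[X]) ^ d) huv
  simpa only [← pow_mul, mul_comm d] using this

open Polynomial in
/-- The explicit form of the binary cyclotomic polynomial. -/
theorem cyclotomic_prime_mul_prime_eq {p q u a : ℕ} (hp : p.Prime) (hq : q.Prime) (hpq : p ≠ q)
    (hu : u ≤ q) (ha : a ≤ p) (h : u * p + a * q = p * q + 1) :
    cyclotomic (p * q) ℤ =
      ∑ w ∈ Finset.range u ×ˢ Finset.range a, X ^ (w.1 * p + w.2 * q) -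
      ∑ w ∈ Finset.Ico u q ×ˢ Finset.Ico a p, X ^ (w.1 * p + w.2 * q - p * q) := by
  have hX : ∀ d : ℕ, 0 < d → (X ^ d - 1 : ℤ[X]) ≠ 0 := fun d hd => by
    simpa using X_pow_sub_C_ne_zero hd (1 : ℤ)
  have hne : (X ^ (p * q) * ((X ^ p - 1) * (X ^ q - 1)) : ℤ[X]) ≠ 0 :=
    mul_ne_zero (pow_ne_zero _ X_ne_zero) (mul_ne_zero (hX p hp.pos) (hX q hq.pos))
  refine mul_right_cancel₀ hne ?_
  have h1 : ∑ w ∈ Finset.range u ×ˢ Finset.range a, (X : ℤ[X]) ^ (w.1 * p + w.2 * q) =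
      (∑ i ∈ Finset.Ico 0 u, X ^ (i * p)) * ∑ j ∈ Finset.Ico 0 a, X ^ (j * q) := by
    rw [Finset.sum_mul_sum, ← Finset.sum_product']
    simp only [pow_add, Finset.range_eq_Ico]
  have h2 : (∑ w ∈ Finset.Ico u q ×ˢ Finset.Ico a p, (X : ℤ[X]) ^ (w.1 * p + w.2 * q - p * q)) *
      X ^ (p * q) = (∑ i ∈ Finset.Ico u q, X ^ (i * p)) * ∑ j ∈ Finset.Ico a p, X ^ (j * q) := by
    rw [Finset.sum_mul_sum, ← Finset.sum_product', Finset.sum_mul]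
    refine Finset.sum_congr rfl fun w hw => ?_
    rw [Finset.mem_product, Finset.mem_Ico, Finset.mem_Ico] at hw
    have h3 := Nat.mul_le_mul_right p hw.1.1
    have h4 := Nat.mul_le_mul_right q hw.2.1
    rw [← pow_add, ← pow_add, Nat.sub_add_cancel (by omega)]
  have g1 := sum_Ico_X_pow_mul p 0 u (Nat.zero_le _)
  have g2 := sum_Ico_X_pow_mul q 0 a (Nat.zero_le _)
  have g3 := sum_Ico_X_pow_mul p u q hu
  have g4 := sum_Ico_X_pow_mul q a p ha
  have h5 : (X : ℤ[X]) ^ (u * p) * X ^ (a * q) = X ^ (p * q) * X := by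
    rw [← pow_add, h, pow_succ]
  rw [zero_mul, pow_zero] at g1 g2
  rw [mul_comm q p] at g3
  have e1 := congrArg₂ (· * ·) g1 g2
  have e2 := congrArg₂ (· * ·) g3 g4
  have h6 := cyclotomic_prime_mul_prime_mul hp hq hpq
  rw [h1, sub_mul]
  linear_combination X ^ (p * q) * h6 - X ^ (p * q) * e1 + e2 +
    (X ^ p - 1) * (X ^ q - 1) * h2 + (1 - X ^ (p * q)) * h5

open Polynomial in
theorem cyclotomic_mul_one_sub_X_pow {p q r : ℕ} (hp : p.Prime) (hq : q.Prime) (hr : r.Prime)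
    (hpq : p ≠ q) (hpr : p ≠ r) (hqr : q ≠ r) :
    cyclotomic (p * q * r) ℤ * (1 - X ^ (p * q)) = expand ℤ r (cyclotomic (p * q) ℤ) *
      ((∑ m ∈ Finset.range p, X ^ m) * (1 - X ^ q)) := by
  have h1 := cyclotomic_expand_eq_cyclotomic_mul hr (n := p * q) (fun h => by
    rcases (Nat.Prime.dvd_mul hr).1 h with h | h
    · exact hpr ((Nat.prime_dvd_prime_iff_eq hr hp).1 h).symm
    · exact hqr ((Nat.prime_dvd_prime_iff_eq hr hq).1 h).symm) ℤ
  have h2 := cyclotomic_prime_mul_prime_mul hp hq hpq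
  have h3 := geom_sum_mul (X : ℤ[X]) p
  rw [h1]
  have hne : (X - 1 : ℤ[X]) ≠ 0 := by simpa using X_sub_C_ne_zero (1 : ℤ)
  refine mul_right_cancel₀ hne ?_
  linear_combination cyclotomic (p * q * r) ℤ * h2 -
    cyclotomic (p * q * r) ℤ * cyclotomic (p * q) ℤ * (1 - X ^ q) * h3

open Polynomial in
theorem natAbs_coeff_le_cycHeight (n k : ℕ) :
    ((cyclotomic n ℤ).coeff k).natAbs ≤ cycHeight n := by
  by_cases hk : k ≤ (cyclotomic n ℤ).natDegree
  · exact Finset.le_sup (f := fun k => ((cyclotomic n ℤ).coeff k).natAbs)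
      (Finset.mem_range.2 (by omega))
  · rw [coeff_eq_zero_of_natDegree_lt (by omega)]
    simp

theorem one_le_cycHeight (n : ℕ) : 1 ≤ cycHeight n := by
  have h := natAbs_coeff_le_cycHeight n (Polynomial.cyclotomic n ℤ).natDegree
  rw [Polynomial.coeff_natDegree, Polynomial.cyclotomic.monic] at h
  simpa using h

open Polynomial in
/-- The polynomial `(1 + X + ⋯ + X ^ (p - 1)) * (1 - X ^ q)` has coefficients `1` on `[0, p)`,
`-1` on `[q, q + p)` and `0` elsewhere. -/
theorem coeff_geom_sum_mul_one_sub {p q : ℕ} (hpq : p ≤ q) (m : ℕ) :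
    ((∑ i ∈ Finset.range p, X ^ i) * (1 - X ^ q) : ℤ[X]).coeff m =
      if m < p then 1 else if q ≤ m ∧ m < q + p then -1 else 0 := by
  have h : ∀ k : ℕ, (∑ i ∈ Finset.range p, X ^ i : ℤ[X]).coeff k = if k < p then 1 else 0 := by
    intro k
    simp [finsetSum_coeff, coeff_X_pow]
  rw [mul_sub, mul_one, coeff_sub, coeff_mul_X_pow', h, h]
  split_ifs <;> first | rfl | omega

theorem eq_and_dvd_of_mul_dvd_sub {p q i i' j j' : ℤ} (hpq : IsCoprime p q)
    (hq : q ≠ 0) (hi : 0 ≤ i) (hiq : i < q) (hi' : 0 ≤ i') (hiq' : i' < q)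
    (h : p * q ∣ (i * p + j * q) - (i' * p + j' * q)) : i = i' ∧ p ∣ j - j' := by
  obtain ⟨c, hc⟩ := h
  have h1 : q ∣ i - i' := by
    refine hpq.symm.dvd_of_dvd_mul_right (z := p) ⟨c * p - (j - j'), ?_⟩
    linear_combination hc
  have h2 : i = i' := by
    obtain ⟨d, hd⟩ := h1
    have h3 : d < 1 := by nlinarith
    have h4 : -1 < d := by nlinarith
    have : d = 0 := by omega
    rw [this] at hd
    linarith
  refine ⟨h2, c, ?_⟩
  subst h2
  refine mul_left_cancel₀ hq ?_
  linear_combination hc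

theorem dvd_sub_mul_of_dvd {d r s x k : ℤ} (h : d ∣ r * s - 1) (hx : d ∣ r * x - k) :
    d ∣ x - k * s := by
  have : x - k * s = s * (r * x - k) - x * (r * s - 1) := by ring
  rw [this]
  exact dvd_sub (dvd_mul_of_dvd_right hx _) (dvd_mul_of_dvd_right h _)

theorem second_positive_empty {p q a M j k : ℤ} (ha : 1 ≤ a) (hap : a < p)
    (hMq : M * p < q) (hj : 0 ≤ j) (hja : j < a) (hk : 0 ≤ k) (hkp : k < p)
    (hdvd : p ∣ j - (a + k))
    (hT : (q - 1 - M * k) * p + j * q ≤ a * q - p + (p - a - 1) * (q - M * p)) : False := by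
  obtain ⟨c, hc⟩ := hdvd
  have h1 : c < 0 := by nlinarith
  have h2 : -2 < c := by nlinarith
  have h3 : c = -1 := by omega
  subst h3
  have h4 : k = p - a + j := by linarith
  subst h4
  have : 0 ≤ j * (q - M * p) := mul_nonneg hj (by linarith)
  nlinarith

theorem first_negative_empty {p q a b M u i j k : ℤ} (ha : 1 ≤ a) (hb : 1 ≤ b) (hba : b ≤ a)
    (hpba : p ≤ b + 2 * a) (hap : 2 * a < p) (hM2 : q * a < 1 + p + (M + 1) * (p * (p - a - 1)))
    (hMp : p ≤ M) (hMq : M * p < q) (hq : 1 + p + p ^ 2 ≤ q) (hu : u * p + a * q = p * q + 1)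
    (hi : u ≤ i) (hik : i = q - 1 - M * k) (hj : a ≤ j) (hjp : j < p) (hk : 0 ≤ k) (hkp : k < p)
    (hdvd : p ∣ j - (a + k + b))
    (hT : i * p + j * q - p * q ≤ a * q - p + (p - a - 1) * (q - M * p)) : False := by
  obtain ⟨c, hc⟩ := hdvd
  have h1 : c < 1 := by nlinarith
  have h2 : -2 < c := by nlinarith
  have hp : 0 < p := by linarith
  rcases (by omega : c = 0 ∨ c = -1) with rfl | rfl
  · have h3 : j = a + k + b := by linarith
    subst h3 hik
    have h4 : 0 ≤ k * (q - M * p) := mul_nonneg hk (by linarith)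
    have h5 : b * q ≤ (p - a - 1) * (q - M * p) := by nlinarith
    have h6 : 0 ≤ (b + 2 * a - p) * q := mul_nonneg (by linarith) (by nlinarith)
    have h7 : 0 ≤ a * p := by positivity
    nlinarith
  · have h3 : k = p - b + (j - a) := by linarith
    have h4 : p - b ≤ k := by linarith
    have h5 : u * p ≤ (q - 1 - M * k) * p := mul_le_mul_of_nonneg_right (by linarith) hp.le
    have h6 : M * p * (p - a) ≤ M * p * k :=
      mul_le_mul_of_nonneg_left (by linarith) (by nlinarith)
    have h7 : p * (p - a - 1) ≤ M * p := by nlinarith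
    nlinarith

open Polynomial in
theorem sum_coeff_sum_X_pow_mul {ι : Type*} (S : Finset ι) (v : ι → ℕ) (c : ℕ → ℤ) (N : ℕ) :
    ∑ f ∈ Finset.range N, (∑ w ∈ S, X ^ v w : ℤ[X]).coeff f * c f =
      ∑ w ∈ S with v w < N, c (v w) := by
  simp only [finsetSum_coeff, coeff_X_pow, Finset.sum_mul, ite_mul, one_mul, zero_mul]
  rw [Finset.sum_comm, Finset.sum_filter]
  refine Finset.sum_congr rfl fun w _ => ?_
  rw [Finset.sum_ite_eq' (Finset.range N) (v w) c]
  simp only [Finset.mem_range]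

/-- Numerical conditions on two primes `p`, `q` and auxiliary parameters under which the
cyclotomic polynomial of order `p * q * r` has a large coefficient, for suitable primes `r`. -/
structure IsAdmissible (p q a b M u T : ℕ) : Prop where
  prime_left : p.Prime
  prime_right : q.Prime
  one_le_a : 1 ≤ a
  one_le_b : 1 ≤ b
  b_le_a : b ≤ a
  le_b_add : p ≤ b + 2 * a
  two_mul_lt : 2 * a < p
  dvd_sub_b : (p : ℤ) ∣ q - b
  u_eq : u * p + a * q = p * q + 1
  le_mul : 1 + p + M * (p * (p - a - 1) : ℤ) ≤ q * a
  lt_mul : (q * a : ℤ) < 1 + p + (M + 1) * (p * (p - a - 1))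
  le_M : p ≤ M
  M_mul_lt : M * p < q
  le_q : 1 + p + p ^ 2 ≤ q
  T_eq : (T : ℤ) = a * q - p + (p - a - 1) * (q - M * p)

namespace IsAdmissible

variable {p q a b M u T : ℕ}

theorem left_lt_right (h : IsAdmissible p q a b M u T) : p < q := by
  have := h.le_q
  nlinarith

theorem u_le (h : IsAdmissible p q a b M u T) : u ≤ q := by
  have h1 := h.u_eq
  have h2 := h.one_le_a
  have h3 := h.prime_right.one_le
  have : u * p ≤ q * p := by nlinarith
  exact Nat.le_of_mul_le_mul_right this h.prime_left.pos

theorem isCoprime (h : IsAdmissible p q a b M u T) : IsCoprime (p : ℤ) q :=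
  Nat.isCoprime_iff_coprime.2
    ((Nat.coprime_primes h.prime_left h.prime_right).2 h.left_lt_right.ne)

theorem mul_le_of_mem (h : IsAdmissible p q a b M u T) {i j : ℕ} (hi : u ≤ i) (hj : a ≤ j) :
    p * q ≤ i * p + j * q := by
  have h1 := h.u_eq
  have h3 := Nat.mul_le_mul_right p hi
  have h4 := Nat.mul_le_mul_right q hj
  omega

theorem false_of_positive (h : IsAdmissible p q a b M u T) {i j m : ℕ} (hi : i < u) (hj : j < a)
    (hv : i * p + j * q ≤ T) (hm2 : q ≤ m) (hm3 : m < q + p)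
    (h1 : (p * q : ℤ) ∣ (i * p + j * q : ℕ) - ((q - 1) * p + a * q) -
      (q + p - 1 - m) * (q - M * p)) : False := by
  have hq0 := h.prime_right.pos
  have hup := h.u_le
  have hap := h.two_mul_lt
  have ha := h.one_le_a
  have hMp' : (M * p : ℤ) < q := by exact_mod_cast h.M_mul_lt
  have hM0 : (p : ℤ) ≤ M := by exact_mod_cast h.le_M
  have hk0 : (0 : ℤ) ≤ q + p - 1 - m := by omega
  have hk1 : (q + p - 1 - m : ℤ) ≤ p - 1 := by omega
  generalize (q + p - 1 - m : ℤ) = k at *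
  have hmk : (M : ℤ) * k ≤ M * p - M := by nlinarith
  have hmk0 : 0 ≤ (M : ℤ) * k := by positivity
  obtain ⟨h2, h3⟩ := eq_and_dvd_of_mul_dvd_sub (i := i) (j := j)
    (i' := q - 1 - M * k) (j' := a + k) h.isCoprime (by omega)
    (by omega) (by omega) (by linarith) (by linarith) (by
      push_cast at h1
      refine h1.trans (dvd_of_eq ?_)
      ring)
  have h4 : ((i * p + j * q : ℕ) : ℤ) ≤ T := by exact_mod_cast hv
  rw [h.T_eq] at h4
  push_cast at h4
  rw [h2] at h4
  exact second_positive_empty (by omega) (by omega) hMp' (by omega) (by omega)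
    (by omega) (by omega) h3 h4

theorem false_of_negative (h : IsAdmissible p q a b M u T) {i j m : ℕ} (hui : u ≤ i) (hiq : i < q)
    (haj : a ≤ j) (hjp : j < p) (hv : i * p + j * q - p * q ≤ T) (hm : m < p)
    (h1 : (p * q : ℤ) ∣ (i * p + j * q - p * q : ℕ) - ((q - 1) * p + a * q) -
      (q + p - 1 - m) * (q - M * p)) : False := by
  have hq0 := h.prime_right.pos
  have hap := h.two_mul_lt
  have ha := h.one_le_a
  have hb := h.one_le_b
  have hba := h.b_le_a
  have hpba := h.le_b_add
  have hMp' : (M * p : ℤ) < q := by exact_mod_cast h.M_mul_lt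
  have hM0 : (p : ℤ) ≤ M := by exact_mod_cast h.le_M
  obtain ⟨d, hd⟩ := h.dvd_sub_b
  rw [Nat.cast_sub (h.mul_le_of_mem hui haj)] at h1
  rw [show (q + p - 1 - m : ℤ) = q + (p - 1 - m) by ring] at h1
  have hk0 : (0 : ℤ) ≤ p - 1 - m := by omega
  have hk1 : (p - 1 - m : ℤ) ≤ p - 1 := by omega
  generalize (p - 1 - m : ℤ) = k at *
  have hmk : (M : ℤ) * k ≤ M * p - M := by nlinarith
  have hmk0 : 0 ≤ (M : ℤ) * k := by positivity
  obtain ⟨h2, h3⟩ := eq_and_dvd_of_mul_dvd_sub (i := i) (j := j)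
    (i' := q - 1 - M * k) (j' := a + k + b) h.isCoprime (by omega)
    (by omega) (by omega) (by linarith) (by linarith) (by
      push_cast at h1
      have h5 : (p * q : ℤ) ∣ p * q * (1 - M + d) := dvd_mul_right _ _
      refine (dvd_add h1 h5).trans (dvd_of_eq ?_)
      linear_combination (-(q : ℤ)) * hd)
  have h4 : ((i * p + j * q - p * q : ℕ) : ℤ) ≤ T := by exact_mod_cast hv
  rw [h.T_eq, Nat.cast_sub (h.mul_le_of_mem hui haj)] at h4
  push_cast at h4
  exact first_negative_empty (u := u) (i := i) (by omega) (by omega) (by omega) (by omega) (by omega)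
    h.lt_mul hM0 hMp' (by exact_mod_cast h.le_q) (by exact_mod_cast h.u_eq) (by exact_mod_cast hui) h2
    (by omega) (by omega) (by omega) (by omega) h3 h4

theorem lattice_point (h : IsAdmissible p q a b M u T) {k : ℕ} (hk : k < p - a) :
    u ≤ q - 1 - M * k ∧ q - 1 - M * k < q ∧
      (q - 1 - M * k) * p + (a + k) * q - p * q ≤ T ∧
      ((q - 1 - M * k : ℕ) : ℤ) = q - 1 - M * k := by
  have hq0 := h.prime_right.pos
  have hM1 := h.le_mul
  have hMp' : (M * p : ℤ) < q := by exact_mod_cast h.M_mul_lt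
  have hM0 : (p : ℤ) ≤ M := by exact_mod_cast h.le_M
  have hkz : (k : ℤ) ≤ p - a - 1 := by omega
  have hMk : (M * k : ℤ) ≤ M * p - M := by nlinarith
  have hcast : ((q - 1 - M * k : ℕ) : ℤ) = q - 1 - M * k := by
    have : M * k ≤ q - 1 := by
      have : (M * k : ℤ) ≤ q - 1 := by linarith
      omega
    rw [Nat.cast_sub this, Nat.cast_sub (by omega)]
    push_cast
    ring
  have huz : (u * p + a * q : ℤ) = p * q + 1 := by exact_mod_cast h.u_eq
  have hMkp : (M * p * k : ℤ) ≤ M * p * (p - a - 1) :=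
    mul_le_mul_of_nonneg_left hkz (by positivity)
  have hu' : (u : ℤ) ≤ q - 1 - M * k := by
    have h1 : (u * p : ℤ) ≤ (q - 1 - M * k) * p := by nlinarith
    exact le_of_mul_le_mul_right h1 (by omega)
  have hu'' : u ≤ q - 1 - M * k := by
    have : (u : ℤ) ≤ (q - 1 - M * k : ℕ) := by rw [hcast]; exact hu'
    exact_mod_cast this
  have hge := h.mul_le_of_mem hu'' (Nat.le_add_right a k)
  refine ⟨hu'', by omega, ?_, hcast⟩
  have : (((q - 1 - M * k) * p + (a + k) * q - p * q : ℕ) : ℤ) ≤ T := by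
    rw [Nat.cast_sub hge, h.T_eq]
    push_cast
    rw [hcast]
    have : (k : ℤ) * (q - M * p) ≤ (p - a - 1) * (q - M * p) :=
      mul_le_mul_of_nonneg_right hkz (by linarith)
    linarith
  exact_mod_cast this

end IsAdmissible

theorem dvd_mul_sub_of_residue {N n r v w Q : ℕ} (h1 : r * v ≤ n) (hn : (N : ℤ) ∣ n - (r * w + Q)) :
    (N : ℤ) ∣ r * (v - w) - (Q - ((n - r * v) % N : ℕ)) := by
  have h2 := (Nat.modEq_iff_dvd (n := N)).1 (Nat.mod_modEq (n - r * v) N)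
  rw [Nat.cast_sub h1] at h2
  refine (dvd_sub hn h2).trans (dvd_of_eq ?_)
  push_cast
  ring

open Polynomial in
theorem natDegree_geom_sum_mul_one_sub_lt {p q : ℕ} (hp : 2 ≤ p) (hpq : p < q) :
    ((∑ m ∈ Finset.range p, X ^ m) * (1 - X ^ q) : ℤ[X]).natDegree < p * q := by
  have h2 : q + p < p * q + 1 := by nlinarith
  by_contra hcon
  have h0 : ((∑ m ∈ Finset.range p, X ^ m) * (1 - X ^ q) : ℤ[X]) ≠ 0 := by
    intro h
    rw [h, natDegree_zero] at hcon
    omega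
  have h1 := leadingCoeff_ne_zero.2 h0
  rw [leadingCoeff, coeff_geom_sum_mul_one_sub hpq.le, if_neg (by omega), if_neg (by omega)] at h1
  exact h1 rfl

open Polynomial in
/-- Admissible parameters force a coefficient of size at least `p - a` in the cyclotomic
polynomial of order `p * q * r`. -/
theorem sub_le_coeff_cyclotomic {p q r a b M u n T : ℕ} (h : IsAdmissible p q a b M u T)
    (hr : r.Prime) (hpqr : p * q < r) (hrs : (p * q : ℤ) ∣ r * (q - M * p) - 1)
    (hnT : n / r = T) (hn : (p * q : ℤ) ∣ n - (r * ((q - 1) * p + a * q) + (q + p - 1))) :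
    (p : ℤ) - a ≤ (cyclotomic (p * q * r) ℤ).coeff n := by
  have hp := h.prime_left
  have hq := h.prime_right
  have hp0 := hp.pos
  have hp2 := hp.two_le
  have hq0 := hq.pos
  have hap := h.two_mul_lt
  have hplt := h.left_lt_right
  have hqr : q < r := by nlinarith
  rw [coeff_of_mul_one_sub_X_pow (Nat.mul_pos hp0 hq.pos) hr.pos
    (natDegree_geom_sum_mul_one_sub_lt hp2 hplt)
    (cyclotomic_mul_one_sub_X_pow hp hq hr hplt.ne (by omega) (by omega)) n, hnT,
    cyclotomic_prime_mul_prime_eq hp hq hplt.ne h.u_le (by omega) h.u_eq]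
  simp only [coeff_sub, sub_mul, Finset.sum_sub_distrib, coeff_geom_sum_mul_one_sub hplt.le]
  set c : ℕ → ℤ := fun v => if (n - r * v) % (p * q) < p then 1 else
      if q ≤ (n - r * v) % (p * q) ∧ (n - r * v) % (p * q) < q + p then -1 else 0 with hc
  have hmod : ∀ v ≤ T, (p * q : ℤ) ∣ r * (v - ((q - 1) * p + a * q)) -
      (q + p - 1 - ((n - r * v) % (p * q) : ℕ)) := by
    intro v hv
    have h1 : r * v ≤ n := by
      rw [← hnT] at hv
      exact (Nat.mul_le_mul_left r hv).trans (Nat.mul_div_le n r)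
    have h2 := dvd_mul_sub_of_residue (N := p * q) (w := (q - 1) * p + a * q) (Q := q + p - 1) h1
    push_cast [Nat.cast_sub (show 1 ≤ q from hq0), Nat.cast_sub (show 1 ≤ q + p by omega)] at h2 ⊢
    exact h2 hn
  have hw : ∀ v ≤ T, (p * q : ℤ) ∣ v - ((q - 1) * p + a * q) -
      (q + p - 1 - ((n - r * v) % (p * q) : ℕ)) * (q - M * p) :=
    fun v hv => dvd_sub_mul_of_dvd hrs (hmod v hv)
  have hpos : ∀ w ∈ (Finset.range u ×ˢ Finset.range a).filter
      (fun w => w.1 * p + w.2 * q < T + 1), 0 ≤ c (w.1 * p + w.2 * q) := by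
    rintro ⟨i, j⟩ hij
    simp only [Finset.mem_filter, Finset.mem_product, Finset.mem_range] at hij
    obtain ⟨⟨hi, hj⟩, hv⟩ := hij
    have hv' := Nat.le_of_lt_succ hv
    simp only [hc]
    split_ifs with hm1 hm2
    · norm_num
    · exact (h.false_of_positive hi hj hv' hm2.1 hm2.2 (hw _ hv')).elim
    · norm_num
  have hneg : ∀ w ∈ (Finset.Ico u q ×ˢ Finset.Ico a p).filter
      (fun w => w.1 * p + w.2 * q - p * q < T + 1), 0 ≤ -c (w.1 * p + w.2 * q - p * q) := by
    rintro ⟨i, j⟩ hij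
    simp only [Finset.mem_filter, Finset.mem_product, Finset.mem_Ico] at hij
    obtain ⟨⟨⟨hui, hiq⟩, haj, hjp⟩, hv⟩ := hij
    have hv' := Nat.le_of_lt_succ hv
    simp only [hc]
    split_ifs with hm1 hm2
    · exact (h.false_of_negative hui hiq haj hjp hv' hm1 (hw _ hv')).elim
    · norm_num
    · norm_num
  have hmany : (p : ℤ) - a ≤ ∑ w ∈ (Finset.Ico u q ×ˢ Finset.Ico a p).filter
      (fun w => w.1 * p + w.2 * q - p * q < T + 1), -c (w.1 * p + w.2 * q - p * q) := by
    have hinj : Set.InjOn (fun k : ℕ => (q - 1 - M * k, a + k)) (Finset.range (p - a)) :=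
      fun x _ y _ hxy => Nat.add_left_cancel (congrArg Prod.snd hxy)
    have hsub : (Finset.range (p - a)).image (fun k : ℕ => (q - 1 - M * k, a + k)) ⊆
        (Finset.Ico u q ×ˢ Finset.Ico a p).filter
          (fun w => w.1 * p + w.2 * q - p * q < T + 1) := by
      intro w hw'
      obtain ⟨k, hk', rfl⟩ := Finset.mem_image.1 hw'
      rw [Finset.mem_range] at hk'
      obtain ⟨h1, h2, h4, _⟩ := h.lattice_point hk'
      simp only [Finset.mem_filter, Finset.mem_product, Finset.mem_Ico]
      exact ⟨⟨⟨h1, h2⟩, by omega, by omega⟩, by omega⟩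
    refine le_trans ?_ (Finset.sum_le_sum_of_subset_of_nonneg hsub fun w hw' _ => hneg w hw')
    rw [Finset.sum_image hinj, Finset.sum_congr rfl (g := fun _ => (1 : ℤ))]
    · simp only [Finset.sum_const, Finset.card_range, nsmul_eq_mul, mul_one]
      omega
    · intro k hk'
      rw [Finset.mem_range] at hk'
      obtain ⟨h1, h2, h4, h5⟩ := h.lattice_point hk'
      have h3 := h.mul_le_of_mem h1 (Nat.le_add_right a k)
      have h6 := hmod _ h4
      simp only [hc]
      have hmlt := Nat.mod_lt (n - r * ((q - 1 - M * k) * p + (a + k) * q - p * q))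
        (Nat.mul_pos hp0 hq0)
      rw [Nat.cast_sub h3] at h6
      generalize (n - r * ((q - 1 - M * k) * p + (a + k) * q - p * q)) % (p * q) = m at *
      push_cast at h6
      rw [h5] at h6
      have h7 : (p * q : ℤ) ∣ m - (q + p - 1 - k) := by
        have h8 := dvd_add (dvd_sub h6 (dvd_mul_of_dvd_right hrs (k : ℤ)))
          (dvd_mul_right (p * q : ℤ) r)
        refine h8.trans (dvd_of_eq ?_)
        ring
      have hpq2 : (q + p : ℤ) ≤ p * q := by
        have : q + p ≤ p * q := by nlinarith
        exact_mod_cast this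
      have h8 : (m : ℤ) - (q + p - 1 - k) = 0 := by
        refine Int.eq_zero_of_abs_lt_dvd h7 ?_
        rw [abs_lt]
        have : (m : ℤ) < p * q := by exact_mod_cast hmlt
        constructor
        · omega
        · omega
      rw [if_neg (by omega), if_pos (by omega)]
      norm_num
  have e1 := sum_coeff_sum_X_pow_mul (Finset.range u ×ˢ Finset.range a)
    (fun w => w.1 * p + w.2 * q) c (T + 1)
  have e2 := sum_coeff_sum_X_pow_mul (Finset.Ico u q ×ˢ Finset.Ico a p)
    (fun w => w.1 * p + w.2 * q - p * q) c (T + 1)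
  simp only [hc] at e1 e2 hpos hmany
  rw [e1, e2]
  have h1 := Finset.sum_nonneg hpos
  rw [Finset.sum_neg_distrib] at hmany
  linarith

theorem exists_isAdmissible {p a b : ℕ} (hp : p.Prime) (hab : a * b ≡ 1 [MOD p]) (hb : 1 ≤ b)
    (hba : b ≤ a) (hpba : p ≤ b + 2 * a) (hap : 2 * a < p) :
    ∃ q M u T : ℕ, IsAdmissible p q a b M u T := by
  have : NeZero p := ⟨hp.ne_zero⟩
  have habz : (a : ZMod p) * b = 1 := by
    have := (ZMod.natCast_eq_natCast_iff _ _ p).2 hab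
    exact_mod_cast this
  obtain ⟨q, hqp, hq, hqb⟩ := Nat.forall_exists_prime_gt_and_eq_mod
    (IsUnit.of_mul_eq_one_right (a : ZMod p) habz) (4 * p ^ 3)
  have hp2 := hp.two_le
  have hpq : 1 + p + p ^ 2 + p ^ 3 ≤ q := by
    have h1 := Nat.pow_le_pow_right hp.pos (show 2 ≤ 3 by norm_num)
    have h2 := Nat.pow_le_pow_right hp.pos (show 1 ≤ 3 by norm_num)
    have h3 := Nat.one_le_pow 3 p hp.pos
    rw [pow_one] at h2
    omega
  obtain ⟨d, hd⟩ : ∃ d : ℕ, p = a + 1 + d := ⟨p - a - 1, by omega⟩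
  have hd1 : a ≤ d := by omega
  have hdp : d ≤ p := by omega
  have hqbz : (p : ℤ) ∣ q - b := by
    have : ((b : ℕ) : ZMod p) = q := hqb.symm
    exact (Nat.modEq_iff_dvd).1 ((ZMod.natCast_eq_natCast_iff _ _ p).1 this)
  have hqa : q * a ≤ p * q := by nlinarith
  obtain ⟨u, hu⟩ : p ∣ p * q + 1 - q * a := by
    rw [← ZMod.natCast_eq_zero_iff, Nat.cast_sub (by omega)]
    push_cast
    rw [hqb, mul_comm (b : ZMod p), habz]
    simp
  have hpd : 0 < p * d := Nat.mul_pos hp.pos (by omega)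
  have hqa1 : 1 + p + p * (p * d) ≤ q * a := by
    have h1 : p * (p * d) ≤ p ^ 3 := by
      calc p * (p * d) ≤ p * (p * p) := by gcongr
        _ = p ^ 3 := by ring
    nlinarith
  have hM := Nat.div_add_mod (q * a - 1 - p) (p * d)
  have hMlt := Nat.mod_lt (q * a - 1 - p) hpd
  have hMp : p ≤ (q * a - 1 - p) / (p * d) := by
    rw [Nat.le_div_iff_mul_le hpd]
    omega
  set M := (q * a - 1 - p) / (p * d)
  have h1 : M * (p * d) + 1 + p ≤ q * a := by
    rw [mul_comm M]; omega
  have h2 : q * a < 1 + p + (M + 1) * (p * d) := by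
    rw [add_mul, mul_comm M]; omega
  have h3 : M * p < q := by
    have : M * p * a ≤ M * p * d := Nat.mul_le_mul_left _ hd1
    have : M * p * a < q * a := by
      rw [← mul_assoc] at h1
      omega
    exact lt_of_mul_lt_mul_right this (Nat.zero_le _)
  obtain ⟨T, hT⟩ : ∃ T : ℕ, (T : ℤ) = a * q - p + (p - a - 1) * (q - M * p) := by
    refine ⟨(a * q - p + (p - a - 1) * (q - M * p) : ℤ).toNat, Int.toNat_of_nonneg ?_⟩
    have h4 : (p : ℤ) ≤ a * q := by
      have : p ≤ a * q := by nlinarith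
      exact_mod_cast this
    have h5 : (0 : ℤ) ≤ q - M * p := by
      have : (M * p : ℤ) < q := by exact_mod_cast h3
      linarith
    have h6 : (0 : ℤ) ≤ p - a - 1 := by omega
    have := mul_nonneg h6 h5
    linarith
  have hdz : (p - a - 1 : ℤ) = d := by omega
  refine ⟨q, M, u, T, hp, hq, by omega, hb, hba, hpba, hap, hqbz, ?_, ?_, ?_, hMp, h3, by omega,
    hT⟩
  · rw [mul_comm u, ← hu, mul_comm a]
    omega
  · rw [hdz]
    have : (M * (p * d) + 1 + p : ℤ) ≤ q * a := by exact_mod_cast h1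
    linarith
  · rw [hdz]
    exact_mod_cast h2

theorem IsAdmissible.exists_prime {p q a b M u T : ℕ} (h : IsAdmissible p q a b M u T) :
    ∃ r : ℕ, r.Prime ∧ q < r ∧ p - a ≤ cycHeight (p * q * r) := by
  have hp := h.prime_left
  have hq := h.prime_right
  have hM := h.M_mul_lt
  have hpos : 0 < p * q := Nat.mul_pos hp.pos hq.pos
  have : NeZero (p * q) := ⟨hpos.ne'⟩
  have hcop : Nat.Coprime (q - M * p) (p * q) := by
    refine Nat.Coprime.mul_right ?_ ?_
    · rw [Nat.coprime_comm, hp.coprime_iff_not_dvd]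
      intro hdvd
      have h1 : p ∣ q := by
        have := dvd_add hdvd (dvd_mul_left p M)
        rwa [Nat.sub_add_cancel hM.le] at this
      exact h.left_lt_right.ne ((Nat.prime_dvd_prime_iff_eq hp hq).1 h1)
    · refine Nat.coprime_of_lt_prime (Nat.sub_ne_zero_of_lt hM) ?_ hq |>.symm
      have h1 : 0 < M * p := Nat.mul_pos (hp.pos.trans_le h.le_M) hp.pos
      exact Nat.sub_lt hq.pos h1
  obtain ⟨r, hrp, hr, hrq⟩ := Nat.forall_exists_prime_gt_and_eq_mod
    (ZMod.unitOfCoprime _ hcop)⁻¹.isUnit (p * q)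
  have hrs : (p * q : ℤ) ∣ r * (q - M * p) - 1 := by
    have h1 : ((r * (q - M * p) : ℕ) : ZMod (p * q)) = (1 : ℕ) := by
      rw [Nat.cast_mul, hrq, ← ZMod.coe_unitOfCoprime _ hcop, Units.inv_mul, Nat.cast_one]
    have h2 := Nat.modEq_iff_dvd.1 ((ZMod.natCast_eq_natCast_iff _ _ _).1 h1.symm)
    push_cast [Nat.cast_sub hM.le] at h2
    exact h2
  set s : ℕ := r * ((q - 1) * p + a * q) + (q + p - 1)
  obtain ⟨n, hnT, hn⟩ : ∃ n, n / r = T ∧ (p * q : ℤ) ∣ n - s := by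
    have hlt := Nat.mod_lt (s + p * q * (r * T) - r * T) hpos
    have hle : r * T ≤ p * q * (r * T) := Nat.le_mul_of_pos_left _ hpos
    refine ⟨r * T + (s + p * q * (r * T) - r * T) % (p * q), ?_, ?_⟩
    · rw [Nat.mul_add_div hr.pos, Nat.div_eq_of_lt (by omega), add_zero]
    · have h1 := Nat.modEq_iff_dvd.1 (Nat.mod_modEq (s + p * q * (r * T) - r * T) (p * q)).symm
      rw [Nat.cast_sub (by omega)] at h1
      have h2 := dvd_add h1 (dvd_mul_right ((p * q : ℕ) : ℤ) (r * T))
      push_cast at h2 ⊢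
      refine h2.trans (dvd_of_eq ?_)
      ring
  refine ⟨r, hr, by nlinarith [hp.one_le], ?_⟩
  have h1 := sub_le_coeff_cyclotomic h hr hrp hrs hnT (by
    have := hq.pos
    have := hp.pos
    push_cast [s, Nat.cast_sub (show 1 ≤ q by omega), Nat.cast_sub (show 1 ≤ q + p by omega)] at hn
    exact hn)
  have h2 := natAbs_coeff_le_cycHeight (p * q * r) n
  omega

theorem stmt_9 (p : ℕ) (hp : p.Prime) :
    ∃ q r : ℕ, q.Prime ∧ r.Prime ∧ p < q ∧ q < r ∧
      2 * (p : ℝ) / 3 - 3 * (p : ℝ) ^ ((3 : ℝ) / 4) * Real.log p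
        < (cycHeight (p * q * r) : ℝ) := by
  by_cases hlog : 3 * (p : ℝ) ^ ((3 : ℝ) / 4) * Real.log p < 2 * (p : ℝ) / 3
  · obtain ⟨a, b, hab, hb, hba, hpba, hap, ha⟩ := exists_inverse_pair_near_third hp hlog
    obtain ⟨q, M, u, T, h⟩ := exists_isAdmissible hp hab hb hba hpba hap
    obtain ⟨r, hr, hqr, hle⟩ := h.exists_prime
    refine ⟨q, r, h.prime_right, hr, h.left_lt_right, hqr, ?_⟩
    have h1 : (p : ℝ) ≤ cycHeight (p * q * r) + a := by
      have : p ≤ cycHeight (p * q * r) + a := by omega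
      exact_mod_cast this
    linarith
  · obtain ⟨q, hpq, hq⟩ := Nat.exists_infinite_primes (p + 1)
    obtain ⟨r, hqr, hr⟩ := Nat.exists_infinite_primes (q + 1)
    refine ⟨q, r, hq, hr, hpq, hqr, ?_⟩
    have h1 : (1 : ℝ) ≤ cycHeight (p * q * r) := by exact_mod_cast one_le_cycHeight _
    linarith
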